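/- arXiv:1511.07969 — 11 statements merged into one kernel-verified Lean document; each statement's English description precedes it below -/
import Mathlib

section
/- Let X be a countable field of characteristic p, where p ≠ 2. Let ξ and η be independent identically distributed random variables with values in X and common distribution given by a probability mass function μ with μ(0) > 0. Then the random variables S = ξ + η and D = (ξ − η)² are independent if and only if μ satisfies the functional equation μ(u)²·μ(v)·μ(−v) = μ(0)²·μ(u+v)·μ(u−v) for all u, v ∈ X. -/
open MeasureTheory ProbabilityTheory

theorem aux_sum {X Ω : Type*} [Countable X] [MeasurableSpace X] [DiscreteMeasurableSpace X]
    [MeasurableSpace Ω] (P : Measure Ω) (D : Ω → X) (hD : Measurable D)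
    (A : Set Ω) (hA : MeasurableSet A) :
    P A = ∑' t, P (A ∩ D ⁻¹' {t}) := by
  rw [← measure_iUnion]
  · congr 1
    ext ω
    simp
  · intro a b hab
    refine Set.disjoint_left.2 ?_
    rintro ω ⟨_, h1⟩ ⟨_, h2⟩
    exact hab (h1.symm.trans h2)
  · intro t
    exact hA.inter (hD (MeasurableSet.of_discrete))

theorem aux_indep {X Ω : Type*} [Countable X] [MeasurableSpace X] [DiscreteMeasurableSpace X]
    [MeasurableSpace Ω] (P : Measure Ω) [IsProbabilityMeasure P] (S D : Ω → X)
    (hS : Measurable S) (hD : Measurable D) :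
    IndepFun S D P ↔ ∀ s t, P (S ⁻¹' {s} ∩ D ⁻¹' {t}) = P (S ⁻¹' {s}) * P (D ⁻¹' {t}) := by
  constructor
  · intro h s t
    exact h.measure_inter_preimage_eq_mul _ _ MeasurableSet.of_discrete MeasurableSet.of_discrete
  · intro h
    rw [indepFun_iff_map_prod_eq_prod_map_map hS.aemeasurable hD.aemeasurable]
    refine Measure.ext_of_singleton ?_
    rintro ⟨s, t⟩
    rw [Measure.map_apply (hS.prodMk hD) (measurableSet_singleton _),
      ← Set.singleton_prod_singleton, Measure.prod_prod,
      Measure.map_apply hS (measurableSet_singleton _),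
      Measure.map_apply hD (measurableSet_singleton _), ← h]
    rfl

theorem aux_iff {X Ω : Type*} [Countable X] [MeasurableSpace X] [DiscreteMeasurableSpace X]
    [MeasurableSpace Ω] (P : Measure Ω) [IsProbabilityMeasure P] (S D : Ω → X)
    (hS : Measurable S) (hD : Measurable D) (z : X)
    (hz : P (S ⁻¹' {z} ∩ D ⁻¹' {z}) ≠ 0) :
    IndepFun S D P ↔ ∀ s t, P (S ⁻¹' {z} ∩ D ⁻¹' {z}) * P (S ⁻¹' {s} ∩ D ⁻¹' {t}) =
      P (S ⁻¹' {s} ∩ D ⁻¹' {z}) * P (S ⁻¹' {z} ∩ D ⁻¹' {t}) := by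
  rw [aux_indep P S D hS hD]
  constructor
  · intro h s t
    simp only [h]
    ring
  · intro h s t
    have hSm : ∀ s, MeasurableSet (S ⁻¹' {s}) := fun s => hS (measurableSet_singleton s)
    have hDm : ∀ s, MeasurableSet (D ⁻¹' {s}) := fun s => hD (measurableSet_singleton s)
    set m := P (S ⁻¹' {z} ∩ D ⁻¹' {z}) with hm
    have hmt : m ≠ ⊤ := measure_ne_top _ _
    have h1 : ∀ s, m * P (S ⁻¹' {s}) = P (S ⁻¹' {s} ∩ D ⁻¹' {z}) * P (S ⁻¹' {z}) := by
      intro s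
      rw [aux_sum P D hD _ (hSm s), aux_sum P D hD _ (hSm z), ← ENNReal.tsum_mul_left,
        ← ENNReal.tsum_mul_left]
      exact tsum_congr (h s)
    have hDs : ∀ t, P (D ⁻¹' {t}) = ∑' s, P (S ⁻¹' {s} ∩ D ⁻¹' {t}) := by
      intro t
      rw [aux_sum P S hS _ (hDm t)]
      simp only [Set.inter_comm]
    have h2 : ∀ t, m * P (D ⁻¹' {t}) = P (D ⁻¹' {z}) * P (S ⁻¹' {z} ∩ D ⁻¹' {t}) := by
      intro t
      rw [hDs t, hDs z, ← ENNReal.tsum_mul_left, ← ENNReal.tsum_mul_right]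
      exact tsum_congr fun s => h s t
    have h3 : m = P (D ⁻¹' {z}) * P (S ⁻¹' {z}) := by
      have e := aux_sum P S hS Set.univ MeasurableSet.univ
      simp only [measure_univ, Set.univ_inter] at e
      calc m = m * ∑' s, P (S ⁻¹' {s}) := by rw [← e, mul_one]
        _ = _ := by
          rw [← ENNReal.tsum_mul_left, hDs z, ← ENNReal.tsum_mul_right]
          exact tsum_congr h1
    have hmm : m * m ≠ 0 := mul_ne_zero hz hz
    have hmmt : m * m ≠ ⊤ := ENNReal.mul_ne_top hmt hmt
    refine (ENNReal.mul_right_inj hmm hmmt).1 ?_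
    calc m * m * P (S ⁻¹' {s} ∩ D ⁻¹' {t}) = m * (m * P (S ⁻¹' {s} ∩ D ⁻¹' {t})) := by ring
      _ = (P (D ⁻¹' {z}) * P (S ⁻¹' {z})) *
          (P (S ⁻¹' {s} ∩ D ⁻¹' {z}) * P (S ⁻¹' {z} ∩ D ⁻¹' {t})) := by rw [h, ← h3]
      _ = (P (S ⁻¹' {s} ∩ D ⁻¹' {z}) * P (S ⁻¹' {z})) *
          (P (D ⁻¹' {z}) * P (S ⁻¹' {z} ∩ D ⁻¹' {t})) := by ring
      _ = (m * P (S ⁻¹' {s})) * (m * P (D ⁻¹' {t})) := by rw [h1, h2]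
      _ = _ := by ring



/-- Lemma 1: for i.i.d. random variables `ξ, η` with values in a countable (discrete) field
of characteristic `p ≠ 2` and common distribution `μ` with `μ(0) > 0`, the random variables
`S = ξ + η` and `D = (ξ - η)²` are independent iff
`μ(u)²·μ(v)·μ(-v) = μ(0)²·μ(u+v)·μ(u-v)` for all `u, v`. -/
theorem indepFun_add_sq_sub_iff_funEq
    {X : Type*} [Field X] [Countable X] [MeasurableSpace X] [DiscreteMeasurableSpace X]
    (p : ℕ) [CharP X p] (hp2 : p ≠ 2)
    {Ω : Type*} [MeasurableSpace Ω] (P : Measure Ω) [IsProbabilityMeasure P]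
    (ξ η : Ω → X) (hξ : Measurable ξ) (hη : Measurable η)
    (hindep : IndepFun ξ η P)
    (μ : PMF X)
    (hξd : Measure.map ξ P = μ.toMeasure)
    (hηd : Measure.map η P = μ.toMeasure)
    (hμ0 : 0 < μ 0) :
    IndepFun (fun ω => ξ ω + η ω) (fun ω => (ξ ω - η ω) ^ 2) P ↔
      ∀ u v : X, (μ u) ^ 2 * μ v * μ (-v) = (μ 0) ^ 2 * μ (u + v) * μ (u - v) := by

  have h2 : (2 : X) ≠ 0 := by
    intro h
    have h' : ((2 : ℕ) : X) = 0 := by exact_mod_cast h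
    rw [CharP.cast_eq_zero_iff X p 2] at h'
    rcases (Nat.dvd_prime Nat.prime_two).1 h' with h1 | h1
    · subst h1
      exact CharP.char_ne_one X 1 rfl
    · exact hp2 h1
  have hJ : ∀ a b : X, P (ξ ⁻¹' {a} ∩ η ⁻¹' {b}) = μ a * μ b := by
    intro a b
    rw [hindep.measure_inter_preimage_eq_mul _ _ (measurableSet_singleton _)
      (measurableSet_singleton _), ← Measure.map_apply hξ (measurableSet_singleton _),
      ← Measure.map_apply hη (measurableSet_singleton _), hξd, hηd,
      PMF.toMeasure_apply_singleton _ _ (measurableSet_singleton _),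
      PMF.toMeasure_apply_singleton _ _ (measurableSet_singleton _)]
  set S : Ω → X := fun ω => ξ ω + η ω with hSdef
  set D : Ω → X := fun ω => (ξ ω - η ω) ^ 2 with hDdef
  have hS : Measurable S :=
    (Measurable.of_discrete (f := fun q : X × X => q.1 + q.2)).comp (hξ.prodMk hη)
  have hD : Measurable D :=
    (Measurable.of_discrete (f := fun q : X × X => (q.1 - q.2) ^ 2)).comp (hξ.prodMk hη)
  have hset : ∀ u v : X, S ⁻¹' {2 * u} ∩ D ⁻¹' {(2 * v) ^ 2} =
      (ξ ⁻¹' {u + v} ∩ η ⁻¹' {u - v}) ∪ (ξ ⁻¹' {u - v} ∩ η ⁻¹' {u + v}) := by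
    intro u v
    ext ω
    simp only [hSdef, hDdef, Set.mem_inter_iff, Set.mem_preimage, Set.mem_singleton_iff,
      Set.mem_union]
    constructor
    · rintro ⟨e1, e2⟩
      rcases sq_eq_sq_iff_eq_or_eq_neg.1 e2 with e | e
      · left
        constructor <;> apply mul_left_cancel₀ h2
        · linear_combination e1 + e
        · linear_combination e1 - e
      · right
        constructor <;> apply mul_left_cancel₀ h2
        · linear_combination e1 + e
        · linear_combination e1 - e
    · rintro (⟨e1, e2⟩ | ⟨e1, e2⟩) <;> rw [e1, e2] <;> constructor <;> ring
  have hJ0 : ∀ u : X, P (S ⁻¹' {2 * u} ∩ D ⁻¹' {0}) = μ u ^ 2 := by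
    intro u
    have := hset u 0
    simp only [mul_zero, add_zero, sub_zero, Set.union_self, ne_eq, OfNat.ofNat_ne_zero,
      not_false_eq_true, zero_pow] at this
    rw [this, hJ, sq]
  have hJ1 : ∀ u v : X, v ≠ 0 →
      P (S ⁻¹' {2 * u} ∩ D ⁻¹' {(2 * v) ^ 2}) = 2 * (μ (u + v) * μ (u - v)) := by
    intro u v hv
    rw [hset, measure_union, hJ, hJ]
    · ring
    · refine Set.disjoint_left.2 ?_
      rintro ω ⟨e1, _⟩ ⟨e2, _⟩
      have e : u + v = u - v := e1.symm.trans e2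
      have : 2 * v = 0 := by linear_combination e
      exact (mul_ne_zero h2 hv) this
    · exact (hξ (measurableSet_singleton _)).inter (hη (measurableSet_singleton _))
  have hJn : ∀ s t : X, (∀ v, t ≠ (2 * v) ^ 2) → P (S ⁻¹' {s} ∩ D ⁻¹' {t}) = 0 := by
    intro s t ht
    have : S ⁻¹' {s} ∩ D ⁻¹' {t} = ∅ := by
      refine Set.eq_empty_of_forall_notMem ?_
      rintro ω ⟨_, e⟩
      have e' : (ξ ω - η ω) ^ 2 = t := e
      apply ht ((ξ ω - η ω) / 2)
      rw [← e', mul_div_cancel₀ _ h2]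
    rw [this, measure_empty]
  have h00 : P (S ⁻¹' {0} ∩ D ⁻¹' {0}) = μ 0 ^ 2 := by
    have := hJ0 0
    rwa [mul_zero] at this
  have hJ2 : ∀ v : X, v ≠ 0 →
      P (S ⁻¹' {0} ∩ D ⁻¹' {(2 * v) ^ 2}) = 2 * (μ v * μ (-v)) := by
    intro v hv
    have := hJ1 0 v hv
    rwa [mul_zero, zero_add, zero_sub] at this
  rw [aux_iff P S D hS hD 0 (by rw [h00]; exact pow_ne_zero _ hμ0.ne')]
  constructor
  · intro h u v
    by_cases hv : v = 0
    · subst hv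
      simp only [neg_zero, add_zero, sub_zero]
      ring
    · have e := h (2 * u) ((2 * v) ^ 2)
      rw [h00, hJ1 u v hv, hJ0, hJ2 v hv] at e
      refine (ENNReal.mul_right_inj (a := 2) (by simp) (by simp)).1 ?_
      calc _ = μ u ^ 2 * (2 * (μ v * μ (-v))) := by ring
        _ = _ := by rw [← e]; ring
  · intro h s t
    by_cases ht : ∃ v, t = (2 * v) ^ 2
    · obtain ⟨v, rfl⟩ := ht
      obtain ⟨u, rfl⟩ : ∃ u, s = 2 * u := ⟨s / 2, (mul_div_cancel₀ _ h2).symm⟩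
      by_cases hv : v = 0
      · subst hv
        simp only [mul_zero, ne_eq, OfNat.ofNat_ne_zero, not_false_eq_true, zero_pow]
        ring
      · rw [h00, hJ1 u v hv, hJ0, hJ2 v hv]
        calc _ = 2 * (μ 0 ^ 2 * μ (u + v) * μ (u - v)) := by ring
          _ = _ := by rw [← h]; ring
    · push Not at ht
      rw [hJn s t ht, hJn 0 t ht]
      simp
end

section
/- Let X be an abelian group with unique division by 2 (i.e. for every x ∈ X there is a unique y ∈ X with 2y = x). Let μ : X → ℝ be a nonnegative function satisfying μ(u)²·μ(v)·μ(−v) = μ(0)²·μ(u+v)·μ(u−v) for all u, v ∈ X, and suppose μ(0) > 0. Then the set K = {x ∈ X : μ(x) ≠ 0} is a subgroup of X. -/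
/-- Lemma 2: if `X` is an abelian group with unique division by 2 and `μ : X → ℝ` is a
nonnegative function with `μ(0) > 0` satisfying
`μ(u)²·μ(v)·μ(-v) = μ(0)²·μ(u+v)·μ(u-v)` for all `u, v`, then
`K = {x : μ(x) ≠ 0}` is a subgroup of `X`. -/
theorem support_is_subgroup
    {X : Type*} [AddCommGroup X]
    (hdiv2 : ∀ x : X, ∃! y : X, y + y = x)
    (μ : X → ℝ) (hnonneg : ∀ x, 0 ≤ μ x)
    (heq : ∀ u v : X, (μ u) ^ 2 * μ v * μ (-v) = (μ 0) ^ 2 * μ (u + v) * μ (u - v))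
    (hμ0 : 0 < μ 0) :
    ∃ K : AddSubgroup X, (K : Set X) = {x : X | μ x ≠ 0} := by
  have h0 : μ 0 ≠ 0 := hμ0.ne'
  have key : ∀ u v : X, (μ u ≠ 0 ∧ μ v ≠ 0 ∧ μ (-v) ≠ 0) ↔ (μ (u + v) ≠ 0 ∧ μ (u - v) ≠ 0) := by
    intro u v
    have h1 : (μ u) ^ 2 * μ v * μ (-v) ≠ 0 ↔ (μ 0) ^ 2 * μ (u + v) * μ (u - v) ≠ 0 := by
      rw [heq u v]
    simpa [h0, not_or, and_assoc] using h1
  have hneg : ∀ x : X, μ x ≠ 0 → μ (-x) ≠ 0 := by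
    intro x hx
    obtain ⟨y, hy, -⟩ := hdiv2 x
    obtain ⟨-, a, b⟩ := (key y y).2 (by rw [hy, sub_self]; exact ⟨hx, h0⟩)
    have h2 := ((key (-y) y).1 ⟨b, a, b⟩).2
    have e : -y - y = -x := by rw [← hy]; abel
    rwa [e] at h2
  exact ⟨{ carrier := {x : X | μ x ≠ 0}
           zero_mem' := h0
           add_mem' := fun {a b} ha hb => ((key a b).1 ⟨ha, hb, hneg b hb⟩).1
           neg_mem' := fun {a} ha => hneg a ha }, rfl⟩
end

section
/- Let X be a countable field of characteristic p, where p > 2. Let ξ and η be independent identically distributed random variables with values in X and common distribution μ (a probability mass function on X). Then the random variables S = ξ + η and D = (ξ − η)² are independent if and only if μ is an idempotent distribution, i.e. there exist a finite additive subgroup K of X and an element x₀ ∈ X such that μ is the uniform distribution on the coset x₀ + K (μ(x) = 1/|K| for x ∈ x₀ + K and μ(x) = 0 otherwise). -/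
open MeasureTheory ProbabilityTheory

namespace AddSq

lemma two_ne {X : Type*} [Field X] (p : ℕ) [CharP X p] (hp2 : 2 < p) : (2 : X) ≠ 0 := by
  intro h
  have h1 : ((2 : ℕ) : X) = 0 := by exact_mod_cast h
  rw [CharP.cast_eq_zero_iff X p] at h1
  exact absurd (Nat.le_of_dvd (by norm_num) h1) (by omega)

lemma half_pow {X : Type*} [Field X] (p : ℕ) [CharP X p] (hp : p.Prime) (hp2 : 2 < p) :
    ∃ n : ℕ, ((2 : X)⁻¹) ^ n = 2 := by
  have h2 : (2 : X) ≠ 0 := two_ne p hp2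
  haveI : Fact p.Prime := ⟨hp⟩
  have hz : (2 : ZMod p) ≠ 0 := two_ne p hp2
  have h := ZMod.pow_card_sub_one_eq_one hz
  have h' : (2 : X) ^ (p - 1) = 1 := by
    have := congrArg (ZMod.castHom (dvd_refl p) X) h
    rw [map_pow, map_one, map_ofNat] at this
    exact this
  refine ⟨p - 2, ?_⟩
  have e : p - 1 = (p - 2) + 1 := by omega
  rw [e, pow_succ] at h'
  rw [inv_pow]
  exact inv_eq_of_mul_eq_one_right h'

lemma core {X : Type*} [Field X] (p : ℕ) [CharP X p] (hp : p.Prime) (hp2 : 2 < p)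
    (f k : X → ℝ) (hf : ∀ x, 0 ≤ f x) (h0 : 0 < f 0)
    (h : ∀ u v, f (u + v) * f (u - v) = f u ^ 2 * k v) :
    ∃ K : AddSubgroup X, ∀ x, (x ∈ K ↔ 0 < f x) ∧ (x ∈ K → f x = f 0) := by
  have h2 : (2 : X) ≠ 0 := two_ne p hp2
  have mid : ∀ a b, 0 < f a → 0 < f b → 0 < f (2⁻¹ * (a + b)) := by
    intro a b ha hb
    have := h (2⁻¹ * (a + b)) (2⁻¹ * (a - b))
    have e1 : 2⁻¹ * (a + b) + 2⁻¹ * (a - b) = a := by field_simp; ring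
    have e2 : 2⁻¹ * (a + b) - 2⁻¹ * (a - b) = b := by field_simp; ring
    rw [e1, e2] at this
    rcases (hf (2⁻¹ * (a + b))).lt_or_eq with h' | h'
    · exact h'
    · rw [← h'] at this
      have := mul_pos ha hb
      nlinarith
  have half : ∀ (n : ℕ) a, 0 < f a → 0 < f ((2⁻¹) ^ n * a) := by
    intro n a ha
    induction n with
    | zero => simpa using ha
    | succ n ih =>
      have := mid _ _ ih h0
      rw [add_zero, ← mul_assoc, ← pow_succ'] at this
      exact this
  obtain ⟨n, hn⟩ := half_pow (X := X) p hp hp2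
  have add : ∀ a b, 0 < f a → 0 < f b → 0 < f (a + b) := by
    intro a b ha hb
    have := half n _ (mid a b ha hb)
    rw [hn, ← mul_assoc, mul_inv_cancel₀ h2, one_mul] at this
    exact this
  have nmul : ∀ (m : ℕ) a, 0 < f a → 0 < f ((m : X) * a) := by
    intro m a ha
    induction m with
    | zero => simpa using h0
    | succ m ih =>
      have := add _ _ ih ha
      push_cast
      rwa [add_mul, one_mul]
  have hpX : (p : X) = 0 := CharP.cast_eq_zero X p
  have neg : ∀ a, 0 < f a → 0 < f (-a) := by
    intro a ha
    have := nmul (p - 1) a ha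
    rw [Nat.cast_sub hp.one_lt.le, hpX] at this
    simpa using this
  let K : AddSubgroup X :=
    { carrier := {x | 0 < f x}
      add_mem' := fun {a b} ha hb => add a b ha hb
      zero_mem' := h0
      neg_mem' := fun {a} ha => neg a ha }
  refine ⟨K, fun x => ⟨Iff.rfl, fun hx => ?_⟩⟩
  have hx : 0 < f x := hx
  have pos : ∀ m : ℕ, 0 < f (m * x) := fun m => nmul m x hx
  have rec1 : ∀ m : ℕ, f ((m + 2 : ℕ) * x) * f (m * x) = f ((m + 1 : ℕ) * x) ^ 2 * k x := by
    intro m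
    have := h ((m + 1 : ℕ) * x) x
    have e1 : ((m + 1 : ℕ) : X) * x + x = (m + 2 : ℕ) * x := by push_cast; ring
    have e2 : ((m + 1 : ℕ) : X) * x - x = m * x := by push_cast; ring
    rwa [e1, e2] at this
  have kpos : 0 < k x := by
    have h1 := mul_pos (pos (0 + 2)) (pos 0)
    rw [rec1 0] at h1
    exact (mul_pos_iff_of_pos_left (pow_pos (pos _) 2)).1 h1
  have rec2 : ∀ m : ℕ, f ((m + 1 : ℕ) * x) * f 0 = f x * k x ^ m * f (m * x) := by
    intro m
    induction m with
    | zero => simp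
    | succ m ih =>
      have h1 := rec1 m
      have h3 := pos m
      apply mul_right_cancel₀ h3.ne'
      calc f ((m + 1 + 1 : ℕ) * x) * f 0 * f (m * x)
          = (f ((m + 2 : ℕ) * x) * f (m * x)) * f 0 := by ring
        _ = f ((m + 1 : ℕ) * x) * k x * (f ((m + 1 : ℕ) * x) * f 0) := by rw [h1]; ring
        _ = _ := by rw [ih]; ring
  have kone : k x = 1 := by
    have h1 := rec2 p
    have e : ((p + 1 : ℕ) : X) * x = x := by push_cast; rw [hpX]; ring
    rw [e, hpX, zero_mul] at h1
    have h3 : k x ^ p = 1 := by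
      apply mul_left_cancel₀ (mul_pos hx h0).ne'
      linarith
    exact (pow_eq_one_iff_of_nonneg kpos.le hp.ne_zero).1 h3
  have rec3 : ∀ m : ℕ, f (m * x) = (f x / f 0) ^ m * f 0 := by
    intro m
    induction m with
    | zero => simp
    | succ m ih =>
      have h1 := rec2 m
      rw [kone, one_pow, mul_one, ih] at h1
      apply mul_right_cancel₀ h0.ne'
      rw [h1, pow_succ]
      field_simp
  have h1 := rec3 p
  rw [hpX, zero_mul] at h1
  have h3 : (f x / f 0) ^ p = 1 := by
    apply mul_right_cancel₀ h0.ne'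
    linarith
  have h4 := (pow_eq_one_iff_of_nonneg (div_pos hx h0).le hp.ne_zero).1 h3
  rwa [div_eq_one_iff_eq h0.ne'] at h4

lemma indep_iff {X Y : Type*} [Countable X] [MeasurableSpace X] [DiscreteMeasurableSpace X]
    [Countable Y] [MeasurableSpace Y] [DiscreteMeasurableSpace Y]
    {Ω : Type*} [MeasurableSpace Ω] (P : Measure Ω) [IsProbabilityMeasure P]
    (S : Ω → X) (D : Ω → Y) (hS : Measurable S) (hD : Measurable D) :
    IndepFun S D P ↔ ∀ s d, P {ω | S ω = s ∧ D ω = d} = P {ω | S ω = s} * P {ω | D ω = d} := by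
  constructor
  · intro h s d
    exact h.measure_inter_preimage_eq_mul {s} {d} (measurableSet_singleton s)
      (measurableSet_singleton d)
  · intro h
    rw [indepFun_iff_map_prod_eq_prod_map_map hS.aemeasurable hD.aemeasurable]
    haveI := Measure.isProbabilityMeasure_map (μ := P) hS.aemeasurable
    haveI := Measure.isProbabilityMeasure_map (μ := P) hD.aemeasurable
    refine Measure.ext_of_singleton ?_
    rintro ⟨s, d⟩
    rw [← Set.singleton_prod_singleton, Measure.prod_prod,
      Measure.map_apply hS (measurableSet_singleton s),
      Measure.map_apply hD (measurableSet_singleton d),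
      Measure.map_apply (hS.prodMk hD)
        ((measurableSet_singleton s).prod (measurableSet_singleton d))]
    exact h s d

open Classical in
lemma joint {X : Type*} [Field X] [Countable X] [MeasurableSpace X] [DiscreteMeasurableSpace X]
    (h2 : (2 : X) ≠ 0)
    {Ω : Type*} [MeasurableSpace Ω] (P : Measure Ω) [IsProbabilityMeasure P]
    (ξ η : Ω → X) (hξ : Measurable ξ) (hη : Measurable η)
    (hindep : IndepFun ξ η P) (μ : PMF X)
    (hξd : Measure.map ξ P = μ.toMeasure) (hηd : Measure.map η P = μ.toMeasure) (s d : X) :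
    P {ω | ξ ω + η ω = s ∧ (ξ ω - η ω) ^ 2 = d} =
      ∑' w : X, if w ^ 2 = d then μ ((s + w) / 2) * μ ((s - w) / 2) else 0 := by
  have e : {ω | ξ ω + η ω = s ∧ (ξ ω - η ω) ^ 2 = d} =
      ⋃ w : X, {ω | (ξ ω = (s + w) / 2 ∧ η ω = (s - w) / 2) ∧ w ^ 2 = d} := by
    ext ω
    simp only [Set.mem_setOf_eq, Set.mem_iUnion]
    constructor
    · rintro ⟨h1, h3⟩
      refine ⟨ξ ω - η ω, ⟨?_, ?_⟩, h3⟩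
      · rw [← h1]; field_simp; ring
      · rw [← h1]; field_simp; ring
    · rintro ⟨w, ⟨h1, h3⟩, h4⟩
      rw [h1, h3]
      refine ⟨by field_simp; ring, ?_⟩
      rw [← h4]; field_simp; ring
  have hind := (indep_iff P ξ η hξ hη).1 hindep
  have a1 : ∀ x, P {ω | ξ ω = x} = μ x := by
    intro x
    rw [← PMF.toMeasure_apply_singleton μ x (measurableSet_singleton x), ← hξd,
      Measure.map_apply hξ (measurableSet_singleton x)]
    rfl
  have a2 : ∀ x, P {ω | η ω = x} = μ x := by
    intro x
    rw [← PMF.toMeasure_apply_singleton μ x (measurableSet_singleton x), ← hηd,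
      Measure.map_apply hη (measurableSet_singleton x)]
    rfl
  rw [e, measure_iUnion]
  · refine tsum_congr fun w => ?_
    split_ifs with hw
    · simp only [hw, and_true]
      rw [hind, a1, a2]
    · simp [hw]
  · intro w w' hww
    rw [Function.onFun, Set.disjoint_left]
    rintro ω ⟨⟨h1, h3⟩, -⟩ ⟨⟨h1', h3'⟩, -⟩
    apply hww
    rw [h1] at h1'
    field_simp at h1'
    exact add_left_cancel h1'
  · intro w
    have m1 : MeasurableSet {ω | ξ ω = (s + w) / 2} := hξ (measurableSet_singleton _)
    have m2 : MeasurableSet {ω | η ω = (s - w) / 2} := hη (measurableSet_singleton _)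
    exact (m1.inter m2).inter (MeasurableSet.const _)

lemma indep_of_factor {X Y : Type*} [Countable X] [MeasurableSpace X] [DiscreteMeasurableSpace X]
    [Countable Y] [MeasurableSpace Y] [DiscreteMeasurableSpace Y]
    {Ω : Type*} [MeasurableSpace Ω] (P : Measure Ω) [IsProbabilityMeasure P]
    (S : Ω → X) (D : Ω → Y) (hS : Measurable S) (hD : Measurable D)
    (G : X → ENNReal) (H : Y → ENNReal)
    (h : ∀ s d, P {ω | S ω = s ∧ D ω = d} = G s * H d) : IndepFun S D P := by
  have mS : ∀ s, MeasurableSet {ω | S ω = s} := fun s => hS (measurableSet_singleton s)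
  have mD : ∀ d, MeasurableSet {ω | D ω = d} := fun d => hD (measurableSet_singleton d)
  have hs : ∀ s, P {ω | S ω = s} = G s * ∑' d, H d := by
    intro s
    have e : {ω | S ω = s} = ⋃ d, {ω | S ω = s ∧ D ω = d} := by ext; simp
    rw [e, measure_iUnion, ← ENNReal.tsum_mul_left]
    · exact tsum_congr fun d => h s d
    · intro d d' hd
      rw [Function.onFun, Set.disjoint_left]
      rintro ω ⟨-, h1⟩ ⟨-, h3⟩
      exact hd (h1.symm.trans h3)
    · exact fun d => (mS s).inter (mD d)
  have hd : ∀ d, P {ω | D ω = d} = (∑' s, G s) * H d := by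
    intro d
    have e : {ω | D ω = d} = ⋃ s, {ω | S ω = s ∧ D ω = d} := by ext; simp
    rw [e, measure_iUnion, ← ENNReal.tsum_mul_right]
    · exact tsum_congr fun s => h s d
    · intro d d' hd
      rw [Function.onFun, Set.disjoint_left]
      rintro ω ⟨h1, -⟩ ⟨h3, -⟩
      exact hd (h1.symm.trans h3)
    · exact fun s => (mS s).inter (mD d)
  have one : (∑' s, G s) * ∑' d, H d = 1 := by
    have e : (Set.univ : Set Ω) = ⋃ s, {ω | S ω = s} := by ext; simp
    rw [← measure_univ (μ := P), e, measure_iUnion, ← ENNReal.tsum_mul_right]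
    · exact tsum_congr fun s => (hs s).symm
    · intro d d' hd
      rw [Function.onFun, Set.disjoint_left]
      intro ω h1 h3
      exact hd (h1.symm.trans h3)
    · exact mS
  rw [indep_iff P S D hS hD]
  intro s d
  rw [h, hs, hd]
  calc G s * H d = G s * H d * ((∑' s, G s) * ∑' d, H d) := by rw [one, mul_one]
    _ = _ := by ring

end AddSq

/-- Theorem 1: for i.i.d. random variables `ξ, η` with values in a countable (discrete) field
of prime characteristic `p > 2` and common distribution `μ`, the random variables
`S = ξ + η` and `D = (ξ - η)²` are independent iff `μ` is an idempotent distribution, i.e.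
the uniform distribution on a coset `x₀ + K` of a finite additive subgroup `K` of `X`. -/
theorem indepFun_add_sq_sub_iff_idempotent
    {X : Type*} [Field X] [Countable X] [MeasurableSpace X] [DiscreteMeasurableSpace X]
    (p : ℕ) [CharP X p] (hp : p.Prime) (hp2 : 2 < p)
    {Ω : Type*} [MeasurableSpace Ω] (P : Measure Ω) [IsProbabilityMeasure P]
    (ξ η : Ω → X) (hξ : Measurable ξ) (hη : Measurable η)
    (hindep : IndepFun ξ η P)
    (μ : PMF X)
    (hξd : Measure.map ξ P = μ.toMeasure)
    (hηd : Measure.map η P = μ.toMeasure) :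
    IndepFun (fun ω => ξ ω + η ω) (fun ω => (ξ ω - η ω) ^ 2) P ↔
      ∃ (K : AddSubgroup X) (x₀ : X), (K : Set X).Finite ∧
        (∀ x : X, x - x₀ ∈ K → μ x = (Nat.card K : ENNReal)⁻¹) ∧
        (∀ x : X, x - x₀ ∉ K → μ x = 0) := by
  have h2 : (2 : X) ≠ 0 := AddSq.two_ne p hp2
  have hS : Measurable (fun ω => ξ ω + η ω) := by
    exact (measurable_from_prod_countable_right (f := fun q : X × X => q.1 + q.2)
      (fun _ => Measurable.of_discrete)).comp (hξ.prodMk hη)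
  have hD : Measurable (fun ω => (ξ ω - η ω) ^ 2) := by
    exact (measurable_from_prod_countable_right (f := fun q : X × X => (q.1 - q.2) ^ 2)
      (fun _ => Measurable.of_discrete)).comp (hξ.prodMk hη)
  have J := AddSq.joint h2 P ξ η hξ hη hindep μ hξd hηd
  classical
  constructor
  · intro hI
    have hI := (AddSq.indep_iff P _ _ hS hD).1 hI
    obtain ⟨A, B, hA⟩ : ∃ A B : X → ℝ, ∀ u v,
        (if v = 0 then 1 else 2) * ((μ (u + v)).toReal * (μ (u - v)).toReal) = A u * B v := by
      refine ⟨fun u => (P {ω | ξ ω + η ω = 2 * u}).toReal,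
        fun v => (P {ω | (ξ ω - η ω) ^ 2 = (2 * v) ^ 2}).toReal, fun u v => ?_⟩
      have h1 := hI (2 * u) ((2 * v) ^ 2)
      rw [J] at h1
      dsimp only
      rw [← ENNReal.toReal_mul (a := P _), ← h1, tsum_eq_sum (s := {2 * v, - (2 * v)})]
      · have e1 : (2 * u + 2 * v) / 2 = u + v := by field_simp
        have e2 : (2 * u - 2 * v) / 2 = u - v := by field_simp
        split_ifs with hv
        · subst hv
          simp [h2]
        · have hne : 2 * v ≠ - (2 * v) := by
            intro h
            have h3 : 2 * (2 * v) = 0 := by linear_combination h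
            simp [h2, hv] at h3
          rw [Finset.sum_pair hne, if_pos rfl, if_pos (by ring), ← sub_eq_add_neg,
            sub_neg_eq_add, e1, e2, mul_comm (μ (u - v)), ← two_mul]
          simp [ENNReal.toReal_mul]
      · intro w hw
        rw [if_neg]
        intro h
        apply hw
        simpa using sq_eq_sq_iff_eq_or_eq_neg.1 h
    obtain ⟨x₀, hx₀⟩ := μ.support_nonempty
    have hx₀' : 0 < (μ x₀).toReal :=
      ENNReal.toReal_pos ((PMF.mem_support_iff _ _).1 hx₀) (μ.apply_ne_top _)
    have hsq : ∀ u, (μ u).toReal ^ 2 = A u * B 0 := by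
      intro u
      have := hA u 0
      simp only [if_true, add_zero, sub_zero, one_mul] at this
      rw [← this, sq]
    have hB0 : B 0 ≠ 0 := by
      intro h
      have := hsq x₀
      rw [h, mul_zero] at this
      exact hx₀'.ne' (pow_eq_zero_iff (by norm_num) |>.1 this)
    obtain ⟨K, hK⟩ := AddSq.core p hp hp2 (fun x => (μ (x + x₀)).toReal)
      (fun v => B v / ((if v = 0 then 1 else 2) * B 0)) (fun _ => ENNReal.toReal_nonneg)
      (by simpa using hx₀') (by
        intro u v
        have h1 := hA (u + x₀) v
        have h3 := hsq (u + x₀)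
        have hc : (if v = 0 then (1 : ℝ) else 2) ≠ 0 := by split_ifs <;> norm_num
        generalize (if v = 0 then (1 : ℝ) else 2) = c at *
        have e1 : u + v + x₀ = u + x₀ + v := by ring
        have e2 : u - v + x₀ = u + x₀ - v := by ring
        simp only [e1, e2]
        rw [h3]
        field_simp
        linear_combination h1)
    have hc : ∀ x, x ∈ K → μ (x + x₀) = μ x₀ := by
      intro x hx
      have := (hK x).2 hx
      simp only [zero_add] at this
      exact (ENNReal.toReal_eq_toReal_iff' (μ.apply_ne_top _) (μ.apply_ne_top _)).1 this
    have hz : ∀ x, x ∉ K → μ (x + x₀) = 0 := by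
      intro x hx
      by_contra h
      exact hx ((hK x).1.2 (ENNReal.toReal_pos h (μ.apply_ne_top _)))
    have hx0 : μ x₀ ≠ 0 := (PMF.mem_support_iff _ _).1 hx₀
    have hsum : ∑' x : X, μ (x + x₀) = 1 := by
      rw [← μ.tsum_coe]
      exact (Equiv.addRight x₀).tsum_eq μ
    have hfin : (K : Set X).Finite := by
      have := ENNReal.finite_const_le_of_tsum_ne_top (a := fun x => μ (x + x₀))
        (by rw [hsum]; simp) hx0
      exact this.subset fun x hx => (hc x hx).ge
    have hval : μ x₀ = (Nat.card K : ENNReal)⁻¹ := by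
      haveI : Finite K := hfin
      haveI := Fintype.ofFinite K
      have h1 : ∑' x : K, μ ((x : X) + x₀) = 1 := by
        rw [← hsum]
        refine tsum_subtype_eq_of_support_subset (f := fun x => μ (x + x₀)) (s := (K : Set X)) ?_
        intro x hx
        by_contra h
        exact hx (hz x h)
      have h3 : ∑' x : K, μ ((x : X) + x₀) = (Nat.card K : ENNReal) * μ x₀ := by
        rw [tsum_congr fun x : K => hc x x.2, tsum_fintype]
        simp
      rw [h3, mul_comm] at h1
      exact ENNReal.eq_inv_of_mul_eq_one_left h1
    refine ⟨K, x₀, hfin, fun x hx => ?_, fun x hx => ?_⟩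
    · rw [← hval, ← hc _ hx, sub_add_cancel]
    · rw [← hz _ hx, sub_add_cancel]
  · rintro ⟨K, x₀, -, hK1, hK0⟩
    obtain ⟨n, hn⟩ := AddSq.half_pow (X := X) p hp hp2
    have dbl : ∀ x, 2 * x ∈ K → x ∈ K := by
      intro x hx
      have h1 : ∀ m : ℕ, 2 ^ m * (2 * x) ∈ K := by
        intro m
        induction m with
        | zero => simpa using hx
        | succ m ih =>
          have := K.add_mem ih ih
          rw [← two_mul, ← mul_assoc, ← pow_succ'] at this
          exact this
      have h3 := h1 n
      have h4 : (2 : X) ^ n * 2 = 1 := by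
        rw [inv_pow] at hn
        have h5 : (2 : X) ^ n ≠ 0 := pow_ne_zero _ h2
        nth_rewrite 2 [← hn]
        exact mul_inv_cancel₀ h5
      rwa [← mul_assoc, h4, one_mul] at h3
    let c : ENNReal := (Nat.card K : ENNReal)⁻¹
    refine AddSq.indep_of_factor P _ _ hS hD
      (fun s => if s / 2 - x₀ ∈ K then 1 else 0)
      (fun d => ∑' w : X, if w ^ 2 = d then (if w / 2 ∈ K then c * c else 0) else 0) ?_
    intro s d
    rw [J, ← ENNReal.tsum_mul_left]
    refine tsum_congr fun w => ?_
    split_ifs with hw h1 h3 h3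
    · rw [hK1, hK1, one_mul]
      · have := K.sub_mem h1 h3
        rwa [show s / 2 - x₀ - w / 2 = (s - w) / 2 - x₀ by ring] at this
      · have := K.add_mem h1 h3
        rwa [show s / 2 - x₀ + w / 2 = (s + w) / 2 - x₀ by ring] at this
    · rw [hK0 ((s + w) / 2), zero_mul, mul_zero]
      intro h
      apply h3
      have := K.sub_mem h h1
      rwa [show (s + w) / 2 - x₀ - (s / 2 - x₀) = w / 2 by ring] at this
    all_goals try simp
    all_goals
      by_contra hcon
      push Not at hcon
      have m1 : (s + w) / 2 - x₀ ∈ K := by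
        by_contra h
        exact hcon.1 (hK0 _ h)
      have m2 : (s - w) / 2 - x₀ ∈ K := by
        by_contra h
        exact hcon.2 (hK0 _ h)
      apply h1
      apply dbl
      have := K.add_mem m1 m2
      rwa [show (s + w) / 2 - x₀ + ((s - w) / 2 - x₀) = 2 * (s / 2 - x₀) by
        field_simp; ring] at this
end

section
/- Let X be a countable field of characteristic 0. Let ξ and η be independent identically distributed random variables with values in X and common distribution μ (a probability mass function on X). If the random variables S = ξ + η and D = (ξ − η)² are independent, then μ is a degenerate distribution, i.e. μ is concentrated at a single point of X. -/
open MeasureTheory ProbabilityTheory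

/-- Theorem 2: for i.i.d. random variables `ξ, η` with values in a countable (discrete) field
of characteristic `0` and common distribution `μ`, if the random variables
`S = ξ + η` and `D = (ξ - η)²` are independent, then `μ` is degenerate. -/
theorem indepFun_add_sq_sub_char_zero_degenerate
    {X : Type*} [Field X] [Countable X] [MeasurableSpace X] [DiscreteMeasurableSpace X]
    [CharZero X]
    {Ω : Type*} [MeasurableSpace Ω] (P : Measure Ω) [IsProbabilityMeasure P]
    (ξ η : Ω → X) (hξ : Measurable ξ) (hη : Measurable η)
    (hindep : IndepFun ξ η P)
    (μ : PMF X)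
    (hξd : Measure.map ξ P = μ.toMeasure)
    (hηd : Measure.map η P = μ.toMeasure)
    (hSD : IndepFun (fun ω => ξ ω + η ω) (fun ω => (ξ ω - η ω) ^ 2) P) :
    ∃ x₀ : X, μ = PMF.pure x₀ := by
  have h2 : (2 : X) ≠ 0 := two_ne_zero
  have hms : ∀ s : Set X, MeasurableSet s := fun s => MeasurableSet.of_discrete
  have e1 : ∀ x, P (ξ ⁻¹' {x}) = μ x := fun x => by
    rw [← Measure.map_apply hξ (hms _), hξd, PMF.toMeasure_apply_singleton _ _ (hms _)]
  have e2 : ∀ x, P (η ⁻¹' {x}) = μ x := fun x => by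
    rw [← Measure.map_apply hη (hms _), hηd, PMF.toMeasure_apply_singleton _ _ (hms _)]
  have joint : ∀ x y, P (ξ ⁻¹' {x} ∩ η ⁻¹' {y}) = μ x * μ y := fun x y => by
    rw [hindep.measure_inter_preimage_eq_mul _ _ (hms _) (hms _), e1, e2]
  have sd := fun s d => hSD.measure_inter_preimage_eq_mul {s} {d} (hms _) (hms _)
  have k0 : ∀ u, μ u * μ u = P ((fun ω => ξ ω + η ω) ⁻¹' {2 * u}) *
      P ((fun ω => (ξ ω - η ω) ^ 2) ⁻¹' {0}) := fun u => by
    rw [← sd, ← joint]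
    congr 1
    ext ω
    simp only [Set.mem_inter_iff, Set.mem_preimage, Set.mem_singleton_iff]
    constructor
    · rintro ⟨h, h'⟩
      rw [h, h']
      constructor <;> ring
    · rintro ⟨h, h'⟩
      have h3 : ξ ω - η ω = 0 := by simpa using h'
      constructor <;> apply mul_left_cancel₀ h2
      · linear_combination h + h3
      · linear_combination h - h3
  have k1 : ∀ u v, v ≠ 0 → 2 * (μ (u + v) * μ (u - v)) =
      P ((fun ω => ξ ω + η ω) ⁻¹' {2 * u}) *
      P ((fun ω => (ξ ω - η ω) ^ 2) ⁻¹' {4 * v ^ 2}) := fun u v hv => by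
    have : (fun ω => ξ ω + η ω) ⁻¹' {2 * u} ∩ (fun ω => (ξ ω - η ω) ^ 2) ⁻¹' {4 * v ^ 2}
        = (ξ ⁻¹' {u + v} ∩ η ⁻¹' {u - v}) ∪ (ξ ⁻¹' {u - v} ∩ η ⁻¹' {u + v}) := by
      ext ω
      simp only [Set.mem_inter_iff, Set.mem_preimage, Set.mem_singleton_iff, Set.mem_union]
      constructor
      · rintro ⟨h, h'⟩
        have h3 : (ξ ω - η ω - 2 * v) * (ξ ω - η ω + 2 * v) = 0 := by linear_combination h'
        rcases mul_eq_zero.1 h3 with h4 | h4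
        · left
          constructor <;> apply mul_left_cancel₀ h2
          · linear_combination h + h4
          · linear_combination h - h4
        · right
          constructor <;> apply mul_left_cancel₀ h2
          · linear_combination h + h4
          · linear_combination h - h4
      · rintro (⟨h, h'⟩ | ⟨h, h'⟩) <;> rw [h, h'] <;> constructor <;> ring
    rw [← sd, this, measure_union _ ((hξ (hms _)).inter (hη (hms _))), joint, joint]
    · ring
    · rw [Set.disjoint_left]
      rintro ω ⟨h, -⟩ ⟨h', -⟩
      simp only [Set.mem_preimage, Set.mem_singleton_iff] at h h'
      apply hv
      apply mul_left_cancel₀ h2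
      linear_combination h' - h
  have key : ∀ u w v, v ≠ 0 → (μ u * μ u) * (μ (w + v) * μ (w - v)) =
      (μ w * μ w) * (μ (u + v) * μ (u - v)) := fun u w v hv => by
    have : 2 * ((μ u * μ u) * (μ (w + v) * μ (w - v))) =
      2 * ((μ w * μ w) * (μ (u + v) * μ (u - v))) := by
      rw [mul_left_comm, k1 w v hv, mul_left_comm 2, k1 u v hv, k0 u, k0 w]
      ring
    exact (ENNReal.mul_right_inj (by norm_num) (by norm_num)).1 this
  have fin : ∀ y, μ y ≠ 0 → {x | μ y ≤ μ x}.Finite := fun y hy =>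
    ENNReal.finite_const_le_of_tsum_ne_top μ.tsum_coe_ne_top hy
  obtain ⟨y₀, hy₀⟩ := μ.support_nonempty
  rw [PMF.mem_support_iff] at hy₀
  obtain ⟨M, hM, hmax⟩ := Set.exists_max_image _ μ (fin y₀ hy₀) ⟨y₀, le_refl (μ y₀)⟩
  have hmax' : ∀ x, μ x ≤ μ M := fun x => by
    rcases le_total (μ y₀) (μ x) with h | h
    · exact hmax x h
    · exact h.trans hM
  have hM0 : μ M ≠ 0 := fun h => hy₀ (le_antisymm (h ▸ hmax' y₀) (zero_le))
  have hMt : μ M ≠ ⊤ := μ.apply_ne_top M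
  have mid : ∀ v y, v ≠ 0 → μ y ≤ μ (M + 2 * v) → μ y ≤ μ (M + v) := fun v y hv h => by
    have h1 := key (M + v) M v hv
    have h3 : (M + v) + v = M + 2 * v := by ring
    rw [h3, add_sub_cancel_right] at h1
    have h4 : (μ M * μ M) * (μ (M + 2 * v) * μ M) ≤ (μ M * μ M) * (μ (M + v) * μ (M + v)) := by
      rw [← h1, mul_comm (μ M * μ M)]
      gcongr <;> apply hmax'
    have hMM : μ M * μ M ≠ 0 := mul_ne_zero hM0 hM0
    have hMMt : μ M * μ M ≠ ⊤ := ENNReal.mul_ne_top hMt hMt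
    have h5 := (ENNReal.mul_le_mul_iff_right hMM hMMt).1 h4
    have h6 : μ y * μ y ≤ μ (M + v) * μ (M + v) :=
      le_trans (mul_le_mul' h (hmax' y)) h5
    by_contra hlt
    push Not at hlt
    exact absurd h6 (not_le.2 (ENNReal.mul_lt_mul hlt hlt))
  refine ⟨M, ?_⟩
  have hz : ∀ y, y ≠ M → μ y = 0 := by
    intro y hy
    by_contra hy0
    have hd : y - M ≠ 0 := sub_ne_zero.2 hy
    have hn : ∀ n : ℕ, μ y ≤ μ (M + (y - M) / 2 ^ n) := by
      intro n
      induction n with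
      | zero => simp
      | succ n ih =>
        apply mid _ _ (div_ne_zero hd (pow_ne_zero _ h2))
        have : 2 * ((y - M) / 2 ^ (n + 1)) = (y - M) / 2 ^ n := by
          field_simp
          ring
        rwa [this]
    refine Set.infinite_of_injective_forall_mem (f := fun n : ℕ => M + (y - M) / 2 ^ n) ?_ hn
      (fin y hy0)
    intro a b hab
    have h3 : (y - M) / 2 ^ a = (y - M) / 2 ^ b := add_left_cancel hab
    rw [div_eq_mul_inv, div_eq_mul_inv] at h3
    replace h3 := inv_injective (mul_left_cancel₀ hd h3)
    have h4 : (2 : ℕ) ^ a = 2 ^ b := by exact_mod_cast h3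
    exact Nat.pow_right_injective le_rfl h4
  have h1 : μ M = 1 := by
    rw [← μ.tsum_coe, tsum_eq_single M hz]
  ext x
  by_cases hx : x = M
  · simp [hx, h1]
  · simp [hx, hz x hx]
end

section
/- Let X be a countable field of characteristic 2. Let ξ and η be independent random variables with values in X and distributions μ and ν (probability mass functions on X). If the random variables S = ξ + η and D = (ξ − η)² are independent, then both μ and ν are degenerate distributions. -/
open MeasureTheory ProbabilityTheory

theorem pmf_pure_of_unique {X : Type*} (μ : PMF X)
    (h : ∀ a a', μ a ≠ 0 → μ a' ≠ 0 → a = a') : ∃ a, μ = PMF.pure a := by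
  obtain ⟨a, ha⟩ := μ.support_nonempty
  have ha0 : μ a ≠ 0 := (μ.mem_support_iff a).1 ha
  have h1 : μ a = 1 := by
    rw [PMF.apply_eq_one_iff]
    ext x
    simp only [PMF.mem_support_iff, Set.mem_singleton_iff]
    exact ⟨fun hx => h x a hx ha0, fun hx => hx ▸ ha0⟩
  refine ⟨a, ?_⟩
  ext x
  by_cases hx : x = a
  · subst hx; simp [h1]
  · rw [PMF.pure_apply, if_neg hx]
    by_contra h0
    exact hx (h x a h0 ha0)

/-- Remark 1: for independent random variables `ξ, η` with values in a countable (discrete)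
field of characteristic `2`, with distributions `μ` and `ν`, if the random variables
`S = ξ + η` and `D = (ξ - η)²` are independent, then `μ` and `ν` are degenerate. -/
theorem indepFun_add_sq_sub_char_two_degenerate
    {X : Type*} [Field X] [Countable X] [MeasurableSpace X] [DiscreteMeasurableSpace X]
    [CharP X 2]
    {Ω : Type*} [MeasurableSpace Ω] (P : Measure Ω) [IsProbabilityMeasure P]
    (ξ η : Ω → X) (hξ : Measurable ξ) (hη : Measurable η)
    (hindep : IndepFun ξ η P)
    (μ ν : PMF X)
    (hξd : Measure.map ξ P = μ.toMeasure)
    (hηd : Measure.map η P = ν.toMeasure)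
    (hSD : IndepFun (fun ω => ξ ω + η ω) (fun ω => (ξ ω - η ω) ^ 2) P) :
    (∃ a : X, μ = PMF.pure a) ∧ (∃ b : X, ν = PMF.pure b) := by
  have hm : ∀ a, P (ξ ⁻¹' {a}) = μ a := fun a => by
    rw [← Measure.map_apply hξ (MeasurableSet.of_discrete), hξd,
      PMF.toMeasure_apply_singleton _ _ MeasurableSet.of_discrete]
  have hn : ∀ a, P (η ⁻¹' {a}) = ν a := fun a => by
    rw [← Measure.map_apply hη (MeasurableSet.of_discrete), hηd,
      PMF.toMeasure_apply_singleton _ _ MeasurableSet.of_discrete]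
  have hpos : ∀ a b, μ a ≠ 0 → ν b ≠ 0 → P (ξ ⁻¹' {a} ∩ η ⁻¹' {b}) ≠ 0 := by
    intro a b ha hb
    rw [hindep.measure_inter_preimage_eq_mul _ _ MeasurableSet.of_discrete
      MeasurableSet.of_discrete, hm, hn]
    exact mul_ne_zero ha hb
  have key : ∀ a b a' b', μ a ≠ 0 → ν b ≠ 0 → μ a' ≠ 0 → ν b' ≠ 0 → a + b = a' + b' := by
    intro a b a' b' ha hb ha' hb'
    have h1 : P ((fun ω => ξ ω + η ω) ⁻¹' {a + b}) ≠ 0 := by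
      intro h0
      refine hpos a b ha hb (measure_mono_null ?_ h0)
      rintro ω ⟨h1, h2⟩
      simp only [Set.mem_preimage, Set.mem_singleton_iff] at h1 h2 ⊢
      rw [h1, h2]
    have h2 : P ((fun ω => (ξ ω - η ω) ^ 2) ⁻¹' {(a' - b') ^ 2}) ≠ 0 := by
      intro h0
      refine hpos a' b' ha' hb' (measure_mono_null ?_ h0)
      rintro ω ⟨h1, h2⟩
      simp only [Set.mem_preimage, Set.mem_singleton_iff] at h1 h2 ⊢
      rw [h1, h2]
    have h3 := mul_ne_zero h1 h2
    rw [← hSD.measure_inter_preimage_eq_mul _ _ MeasurableSet.of_discrete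
      MeasurableSet.of_discrete] at h3
    obtain ⟨ω, hω1, hω2⟩ := nonempty_of_measure_ne_zero h3
    simp only [Set.mem_preimage, Set.mem_singleton_iff, CharTwo.sub_eq_add] at hω1 hω2
    rw [hω1] at hω2
    exact CharTwo.sq_injective hω2
  obtain ⟨a₀, ha₀⟩ := μ.support_nonempty
  obtain ⟨b₀, hb₀⟩ := ν.support_nonempty
  rw [PMF.mem_support_iff] at ha₀ hb₀
  exact ⟨pmf_pure_of_unique μ fun a a' h h' => add_right_cancel (key a b₀ a' b₀ h hb₀ h' hb₀),
    pmf_pure_of_unique ν fun b b' h h' => add_left_cancel (key a₀ b a₀ b' ha₀ h ha₀ h')⟩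
end

section
/- Let X be a countable field of characteristic p with p > 2, and let e denote the unit of X. Let ξ and η be independent random variables with values in X such that ξ has distribution μ = ½(E_{−e} + E_{e}) (mass ½ at e and ½ at −e) and η has the degenerate distribution E_0 at 0. Then the random variables S = ξ + η and D = (ξ − η)² are independent, although μ is not an idempotent distribution. -/
open MeasureTheory ProbabilityTheory

/-- Remark 2 (example): let `X` be a countable (discrete) field of prime characteristic
`p > 2` with unit `e = 1`. If `ξ, η` are independent random variables with values in `X`,
`ξ` with distribution `μ = ½(E_{-e} + E_e)` and `η` with the degenerate distribution `E_0`,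
then `S = ξ + η` and `D = (ξ - η)²` are independent, although `μ` is not an idempotent
distribution (a uniform distribution on a coset of a finite additive subgroup). -/
theorem indep_add_sq_sub_counterexample
    {X : Type*} [Field X] [Countable X] [DecidableEq X]
    [MeasurableSpace X] [DiscreteMeasurableSpace X]
    (p : ℕ) [CharP X p] (hp : p.Prime) (hp2 : 2 < p)
    {Ω : Type*} [MeasurableSpace Ω] (P : Measure Ω) [IsProbabilityMeasure P]
    (ξ η : Ω → X) (hξ : Measurable ξ) (hη : Measurable η)
    (hindep : IndepFun ξ η P)
    (μ ν : PMF X)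
    (hμ : ∀ x : X, μ x = if x = (1 : X) then 1 / 2 else if x = (-1 : X) then 1 / 2 else 0)
    (hν : ν = PMF.pure (0 : X))
    (hξd : Measure.map ξ P = μ.toMeasure)
    (hηd : Measure.map η P = ν.toMeasure) :
    IndepFun (fun ω => ξ ω + η ω) (fun ω => (ξ ω - η ω) ^ 2) P ∧
      ¬ ∃ (K : AddSubgroup X) (x₀ : X), (K : Set X).Finite ∧
          (∀ x : X, x - x₀ ∈ K → μ x = (Nat.card K : ENNReal)⁻¹) ∧
          (∀ x : X, x - x₀ ∉ K → μ x = 0) := by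
  have h2 : (2 : X) ≠ 0 := by
    intro h
    have h' : ((2 : ℕ) : X) = 0 := by exact_mod_cast h
    rw [CharP.cast_eq_zero_iff X p] at h'
    exact absurd (Nat.le_of_dvd (by norm_num) h') (by omega)
  have key : ∀ (f : Ω → X) (κ : PMF X) (q : X → Prop), Measurable f →
      Measure.map f P = κ.toMeasure → (∀ x, κ x ≠ 0 → q x) → ∀ᵐ ω ∂P, q (f ω) := by
    intro f κ q hf hd hq
    have : ∀ᵐ x ∂(Measure.map f P), q x := by
      rw [hd, ae_iff, PMF.toMeasure_apply_eq_zero_iff _ (MeasurableSet.of_discrete),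
        Set.disjoint_left]
      intro x hx hn
      exact hn (hq x ((PMF.mem_support_iff _ _).1 hx))
    exact ae_of_ae_map hf.aemeasurable this
  have hm : ∀ x, μ x ≠ 0 → x = 1 ∨ x = -1 := by
    intro x hx
    by_contra hc
    rw [not_or] at hc
    exact hx (by rw [hμ, if_neg hc.1, if_neg hc.2])
  have m1 : μ 1 ≠ 0 := by rw [hμ]; simp
  have m2 : μ (-1) ≠ 0 := by rw [hμ]; simp
  constructor
  · have a1 := key ξ μ _ hξ hξd hm
    have a2 := key η ν (fun x => x = 0) hη hηd (by
      intro x hx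
      rw [hν, PMF.pure_apply] at hx
      by_contra hc
      exact hx (if_neg hc))
    have hc : IndepFun (fun ω => ξ ω + η ω) (fun _ => (1 : X)) P := indepFun_const_right _ _
    refine hc.congr (Filter.EventuallyEq.refl _ _) ?_
    filter_upwards [a1, a2] with ω h1 h0
    rw [h0]
    rcases h1 with h | h <;> rw [h] <;> ring
  · rintro ⟨K, x₀, -, hK, hK'⟩
    have k1 : 1 - x₀ ∈ K := by
      by_contra h
      exact m1 (hK' _ h)
    have k2 : -1 - x₀ ∈ K := by
      by_contra h
      exact m2 (hK' _ h)
    have k3 : (3 : X) - x₀ ∈ K := by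
      have := K.add_mem k1 (K.sub_mem k1 k2)
      convert this using 1
      ring
    have m3 : μ 3 ≠ 0 := by rw [hK _ k3, ← hK _ k1]; exact m1
    rcases hm _ m3 with h | h
    · exact h2 (by linear_combination h)
    · exact mul_ne_zero h2 h2 (by linear_combination h)
end

section
/- Let p be a prime number with p > 2 and let T : ℚ_p² → ℚ_p² be the mapping T(x, y) = (x + y, (x − y)²). Let x₀, y₀ ∈ ℚ_p with |x₀ − y₀|_p = p^{−l} for an integer l. Then for every integer k ≥ l + 1, the image of the set (x₀, y₀) + (p^k ℤ_p)² under T equals (x₀ + y₀, (x₀ − y₀)²) + (p^k ℤ_p) × (p^{k+l} ℤ_p). -/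
theorem aux_norm_two (p : ℕ) [Fact p.Prime] (hp : 2 < p) : ‖(2 : ℚ_[p])‖ = 1 := by
  have h := (Padic.norm_natCast_eq_one_iff (p := p) (n := 2)).2
    ((Nat.coprime_primes Fact.out Nat.prime_two).2 (by omega))
  simpa using h

theorem aux_sub_le {p : ℕ} [Fact p.Prime] {a b : ℚ_[p]} {r : ℝ} (ha : ‖a‖ ≤ r) (hb : ‖b‖ ≤ r) :
    ‖a - b‖ ≤ r := by
  rw [sub_eq_add_neg]
  exact (Padic.nonarchimedean a (-b)).trans (max_le ha (by rwa [norm_neg]))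

theorem aux_add_le {p : ℕ} [Fact p.Prime] {a b : ℚ_[p]} {r : ℝ} (ha : ‖a‖ ≤ r) (hb : ‖b‖ ≤ r) :
    ‖a + b‖ ≤ r :=
  (Padic.nonarchimedean a b).trans (max_le ha hb)

theorem aux_sqrt (p : ℕ) [Fact p.Prime] (hp : 2 < p) (u : ℚ_[p]) (hu : ‖u‖ < 1) :
    ∃ s : ℚ_[p], s ^ 2 = 1 + u ∧ ‖s - 1‖ ≤ ‖u‖ := by
  have h2 := aux_norm_two p hp
  have h2' : ‖(2 : ℤ_[p])‖ = 1 := by rw [PadicInt.norm_def]; exact_mod_cast h2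
  let u' : ℤ_[p] := ⟨u, hu.le⟩
  let F : Polynomial ℤ_[p] := Polynomial.X ^ 2 - Polynomial.C (1 + u')
  have hF : ∀ z : ℤ_[p], F.aeval z = z ^ 2 - (1 + u') := by intro z; simp [F]
  have hF' : ∀ z : ℤ_[p], F.derivative.aeval z = 2 * z := by
    intro z; simp [F]; left; norm_num
  have hu' : ‖u'‖ < 1 := hu
  obtain ⟨z, hz, hz1, -, -⟩ := hensels_lemma (p := p) (F := F) (a := (1 : ℤ_[p])) (by
    rw [hF, hF']; simp [h2']; exact hu)
  rw [hF] at hz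
  rw [hF', mul_one, h2'] at hz1
  have hz2 : (z : ℚ_[p]) ^ 2 = 1 + u := by
    have h := congrArg (fun t : ℤ_[p] => (t : ℚ_[p])) (sub_eq_zero.1 hz)
    simp only [PadicInt.coe_add, PadicInt.coe_pow, PadicInt.coe_one] at h
    exact h
  have hz1' : ‖(z : ℚ_[p]) - 1‖ < 1 := by
    rw [PadicInt.norm_def] at hz1; simpa using hz1
  refine ⟨z, hz2, ?_⟩
  have h3 : ‖(z : ℚ_[p]) + 1‖ = 1 := by
    have : (z : ℚ_[p]) + 1 = (z - 1) + 2 := by ring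
    rw [this, Padic.add_eq_max_of_ne (by rw [h2]; exact hz1'.ne), h2]
    exact max_eq_right hz1'.le
  have h4 : u = ((z : ℚ_[p]) - 1) * (z + 1) := by linear_combination -hz2
  rw [h4, norm_mul, h3, mul_one]

/-- Lemma 4: let `p > 2` be prime, `T(x, y) = (x + y, (x - y)²)` and `x₀, y₀ ∈ ℚ_p` with
`|x₀ - y₀|_p = p^{-l}`. Then for every `k ≥ l + 1`,
`T((x₀, y₀) + (p^k ℤ_p)²) = (x₀ + y₀, (x₀ - y₀)²) + (p^k ℤ_p) × (p^{k+l} ℤ_p)`. -/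
theorem image_T_ball (p : ℕ) [Fact p.Prime] (hp : 2 < p)
    (x₀ y₀ : ℚ_[p]) (l : ℤ) (hxy : ‖x₀ - y₀‖ = (p : ℝ) ^ (-l))
    (k : ℤ) (hk : l + 1 ≤ k) :
    (fun q : ℚ_[p] × ℚ_[p] => (q.1 + q.2, (q.1 - q.2) ^ 2)) ''
        {q : ℚ_[p] × ℚ_[p] | ‖q.1 - x₀‖ ≤ (p : ℝ) ^ (-k) ∧ ‖q.2 - y₀‖ ≤ (p : ℝ) ^ (-k)} =
      {q : ℚ_[p] × ℚ_[p] | ‖q.1 - (x₀ + y₀)‖ ≤ (p : ℝ) ^ (-k) ∧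
        ‖q.2 - (x₀ - y₀) ^ 2‖ ≤ (p : ℝ) ^ (-(k + l))} := by
  have h2 := aux_norm_two p hp
  have hp0 : (0 : ℝ) < p := by positivity
  have hp1 : (1 : ℝ) < p := by exact_mod_cast (by omega : 1 < p)
  have h20 : (2 : ℚ_[p]) ≠ 0 := by
    intro h; rw [h] at h2; simp at h2
  have hkl : (p : ℝ) ^ (-k) ≤ (p : ℝ) ^ (-l) := zpow_le_zpow_right₀ hp1.le (by omega)
  ext ⟨a, b⟩
  simp only [Set.mem_image, Set.mem_setOf_eq, Prod.mk.injEq, Prod.exists]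
  constructor
  · rintro ⟨x, y, ⟨hx, hy⟩, rfl, rfl⟩
    constructor
    · have : x + y - (x₀ + y₀) = (x - x₀) + (y - y₀) := by ring
      rw [this]
      exact aux_add_le hx hy
    · have : (x - y) ^ 2 - (x₀ - y₀) ^ 2
          = ((x - x₀) - (y - y₀)) * (((x - x₀) - (y - y₀)) + 2 * (x₀ - y₀)) := by ring
      rw [this, norm_mul, neg_add, zpow_add₀ hp0.ne']
      have he := aux_sub_le hx hy
      refine mul_le_mul he (aux_add_le (he.trans hkl) ?_) (norm_nonneg _) (by positivity)
      rw [norm_mul, h2, one_mul, hxy]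
  · rintro ⟨ha, hb⟩
    have hd : x₀ - y₀ ≠ 0 := by
      rw [← norm_pos_iff, hxy]; positivity
    have hu : ‖(b - (x₀ - y₀) ^ 2) / (x₀ - y₀) ^ 2‖ ≤ (p : ℝ) ^ (l - k) := by
      rw [norm_div, norm_pow, hxy, div_le_iff₀ (by positivity), sq ((p : ℝ) ^ (-l)), ← zpow_add₀ hp0.ne',
        ← zpow_add₀ hp0.ne']
      refine hb.trans (le_of_eq ?_)
      congr 1
      ring
    obtain ⟨s, hs, hs1⟩ := aux_sqrt p hp _
      (hu.trans_lt (zpow_lt_one_of_neg₀ hp1 (by omega)))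
    have hv : ‖(x₀ - y₀) * s - (x₀ - y₀)‖ ≤ (p : ℝ) ^ (-k) := by
      have : (x₀ - y₀) * s - (x₀ - y₀) = (x₀ - y₀) * (s - 1) := by ring
      rw [this, norm_mul, hxy]
      calc _ ≤ (p : ℝ) ^ (-l) * (p : ℝ) ^ (l - k) := by
            gcongr
            exact hs1.trans hu
        _ = _ := by rw [← zpow_add₀ hp0.ne']; congr 1; ring
    have hv2 : ((x₀ - y₀) * s) ^ 2 = b := by
      rw [mul_pow, hs]; field_simp; ring
    generalize (x₀ - y₀) * s = v at hv hv2
    refine ⟨(a + v) / 2, (a - v) / 2, ⟨?_, ?_⟩, ?_, ?_⟩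
    · have : (a + v) / 2 - x₀ = ((a - (x₀ + y₀)) + (v - (x₀ - y₀))) / 2 := by field_simp; ring
      rw [this, norm_div, h2, div_one]
      exact aux_add_le ha hv
    · have : (a - v) / 2 - y₀ = ((a - (x₀ + y₀)) - (v - (x₀ - y₀))) / 2 := by field_simp; ring
      rw [this, norm_div, h2, div_one]
      exact aux_sub_le ha hv
    · field_simp; ring
    · rw [← hv2]; field_simp; ring
end

section
/- Let p > 2 be prime, and let 𝔰 : ℚ_p^{[2]} → ℚ_p be the continuous square-root function of Lemma 3 (satisfying 𝔰(x)² = x, 𝔰(p^{2l}c) = p^l 𝔰(c), and mapping each ball of square units into a fixed coset of p·ℤ_p). Define S₁(u, v) = ((u + 𝔰(v))/2, (u − 𝔰(v))/2) and S₂(u, v) = ((u − 𝔰(v))/2, (u + 𝔰(v))/2) on ℚ_p × ℚ_p^{[2]}. Let (u₀, v₀) ∈ ℚ_p × ℚ_p^{[2]} with |𝔰(v₀)|_p = p^{−l}, and set E_k = (u₀, v₀) + (p^k ℤ_p) × (p^{k+l} ℤ_p). Then for every k ≥ l + 1, the images S₁(E_k) and S₂(E_k) are disjoint. -/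
theorem aux_two {p : ℕ} [Fact p.Prime] (hp : 2 < p) : ‖(2 : ℚ_[p])‖ = 1 := by
  have := (Padic.norm_natCast_eq_one_iff (p := p) (n := 2)).2
    ((Nat.coprime_primes Fact.out Nat.prime_two).2 (by omega))
  simpa using this

theorem aux_sq {p : ℕ} [Fact p.Prime] (hp : 2 < p) (w : ℚ_[p]) (hw : ‖w - 1‖ < 1) :
    ∃ t : ℚ_[p], w = t ^ 2 := by
  have hw1 : ‖w‖ ≤ 1 := by
    have := Padic.nonarchimedean (w - 1) 1
    simp only [sub_add_cancel, norm_one] at this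
    exact this.trans (max_le hw.le le_rfl)
  let W : ℤ_[p] := ⟨w, hw1⟩
  have h2 : ‖(2 : ℤ_[p])‖ = 1 := by
    have := aux_two hp
    rw [PadicInt.norm_def]; exact this
  have hW : ‖1 - W‖ < 1 := by
    rw [norm_sub_rev, PadicInt.norm_def]; exact hw
  obtain ⟨z, hz, -⟩ := hensels_lemma (p := p) (R := ℤ_[p])
    (F := (Polynomial.X ^ 2 - Polynomial.C W : Polynomial ℤ_[p])) (a := 1) (by
      simpa [one_add_one_eq_two, h2] using hW)
  have hz' : z ^ 2 = W := by simpa [sub_eq_zero] using hz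
  refine ⟨z, ?_⟩
  have := congrArg (fun y : ℤ_[p] => (y : ℚ_[p])) hz'
  simpa [W] using this.symm

/-- Lemma 5 (ii): let `p > 2` be prime, `𝔰` the continuous square-root function of Lemma 3
(so `𝔰(x)² = x` on squares, `𝔰(p^{2l}c) = p^l 𝔰(c)` for square units `c`, and `𝔰` maps each
ball of square units into a fixed coset of `pℤ_p`), and
`S₁(u, v) = ((u + 𝔰(v))/2, (u - 𝔰(v))/2)`, `S₂(u, v) = ((u - 𝔰(v))/2, (u + 𝔰(v))/2)`.
Let `(u₀, v₀) ∈ ℚ_p × ℚ_p^{[2]}` with `|𝔰(v₀)|_p = p^{-l}` and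
`E_k = (u₀, v₀) + (p^k ℤ_p) × (p^{k+l} ℤ_p)`. Then for every `k ≥ l + 1`, the images
`S₁(E_k)` and `S₂(E_k)` are disjoint. -/
theorem S1_S2_images_disjoint (p : ℕ) [Fact p.Prime] (hp : 2 < p)
    (s : ℚ_[p] → ℚ_[p])
    (hs_cont : ContinuousOn s {x : ℚ_[p] | ∃ t : ℚ_[p], x = t ^ 2})
    (hs_sq : ∀ x : ℚ_[p], (∃ t : ℚ_[p], x = t ^ 2) → (s x) ^ 2 = x)
    (hs_scale : ∀ (l : ℤ) (c : ℚ_[p]), ‖c‖ = 1 → (∃ t : ℚ_[p], c = t ^ 2) →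
      s ((p : ℚ_[p]) ^ (2 * l) * c) = (p : ℚ_[p]) ^ l * s c)
    (hs_coset : ∀ c v : ℚ_[p], ‖c‖ = 1 → (∃ t : ℚ_[p], c = t ^ 2) →
      (∃ t : ℚ_[p], v = t ^ 2) → ‖v - c‖ ≤ (p : ℝ)⁻¹ → ‖s v - s c‖ ≤ (p : ℝ)⁻¹)
    (u₀ v₀ : ℚ_[p]) (hv₀ : ∃ t : ℚ_[p], v₀ = t ^ 2)
    (l : ℤ) (hl : ‖s v₀‖ = (p : ℝ) ^ (-l))
    (k : ℤ) (hk : l + 1 ≤ k) :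
    Disjoint
      ((fun q : ℚ_[p] × ℚ_[p] => ((q.1 + s q.2) / 2, (q.1 - s q.2) / 2)) ''
        {q : ℚ_[p] × ℚ_[p] | ‖q.1 - u₀‖ ≤ (p : ℝ) ^ (-k) ∧ ‖q.2 - v₀‖ ≤ (p : ℝ) ^ (-(k + l))})
      ((fun q : ℚ_[p] × ℚ_[p] => ((q.1 - s q.2) / 2, (q.1 + s q.2) / 2)) ''
        {q : ℚ_[p] × ℚ_[p] | ‖q.1 - u₀‖ ≤ (p : ℝ) ^ (-k) ∧ ‖q.2 - v₀‖ ≤ (p : ℝ) ^ (-(k + l))}) := by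
  have hp0 : (0 : ℝ) < p := by positivity
  have hp1 : (1 : ℝ) < p := by exact_mod_cast (by omega : 1 < p)
  have hpne : (p : ℚ_[p]) ≠ 0 := by exact_mod_cast (Fact.out : p.Prime).ne_zero
  have hnv₀ : ‖v₀‖ = (p : ℝ) ^ (-(2 * l)) := by
    rw [← hs_sq v₀ hv₀, norm_pow, hl, ← zpow_natCast, ← zpow_mul]
    congr 1; push_cast; ring
  have hv₀ne : v₀ ≠ 0 := by
    rw [← norm_pos_iff, hnv₀]; positivity
  have hsqs : ∀ v : ℚ_[p], (∃ t : ℚ_[p], v = t ^ 2) →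
      ∃ t : ℚ_[p], (p : ℚ_[p]) ^ (-(2 * l)) * v = t ^ 2 := by
    rintro v ⟨t, rfl⟩
    refine ⟨(p : ℚ_[p]) ^ (-l) * t, ?_⟩
    rw [mul_pow, ← zpow_natCast ((p : ℚ_[p]) ^ (-l)), ← zpow_mul]
    congr 2; push_cast; ring
  have hcan : ∀ v : ℚ_[p], (p : ℚ_[p]) ^ (2 * l) * ((p : ℚ_[p]) ^ (-(2 * l)) * v) = v := by
    intro v
    rw [← mul_assoc, ← zpow_add₀ hpne]; simp
  have key : ∀ v : ℚ_[p], ‖v - v₀‖ ≤ (p : ℝ) ^ (-(k + l)) →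
      ‖s v - s v₀‖ < (p : ℝ) ^ (-l) := by
    intro v hv
    have hv1 : ‖v - v₀‖ ≤ (p : ℝ) ^ (-(2 * l) - 1) :=
      hv.trans (zpow_le_zpow_right₀ hp1.le (by omega))
    have hlt : ‖v - v₀‖ < ‖v₀‖ := by
      rw [hnv₀]
      exact hv1.trans_lt (zpow_lt_zpow_right₀ hp1 (by omega))
    have hvsq : ∃ t : ℚ_[p], v = t ^ 2 := by
      obtain ⟨t, ht⟩ := aux_sq hp (v / v₀) (by
        rw [div_sub_one hv₀ne, norm_div, div_lt_one (norm_pos_iff.2 hv₀ne)]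
        exact hlt)
      obtain ⟨r, hr⟩ := hv₀
      refine ⟨t * r, ?_⟩
      rw [mul_pow, ← ht, ← hr, div_mul_cancel₀ _ hv₀ne]
    have hnv : ‖v‖ = ‖v₀‖ := by
      have h := Padic.add_eq_max_of_ne (q := v - v₀) (r := v₀) hlt.ne
      rw [sub_add_cancel, max_eq_right hlt.le] at h
      exact h
    have hunit : ∀ x : ℚ_[p], ‖x‖ = (p : ℝ) ^ (-(2 * l)) →
        ‖(p : ℚ_[p]) ^ (-(2 * l)) * x‖ = 1 := by
      intro x hx
      rw [norm_mul, hx, Padic.norm_p_zpow, ← zpow_add₀ hp0.ne']; simp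
    have h1 := hs_coset _ _ (hunit v₀ hnv₀) (hsqs v₀ hv₀) (hsqs v hvsq) (by
      rw [← mul_sub, norm_mul, Padic.norm_p_zpow]
      calc _ ≤ (p : ℝ) ^ (-(-(2 * l))) * (p : ℝ) ^ (-(2 * l) - 1) := by gcongr
        _ = (p : ℝ)⁻¹ := by
          rw [← zpow_add₀ hp0.ne', ← zpow_neg_one]; congr 1; ring)
    have e1 := hs_scale l _ (hunit v₀ hnv₀) (hsqs v₀ hv₀)
    have e2 := hs_scale l _ (hunit v (hnv.trans hnv₀)) (hsqs v hvsq)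
    rw [hcan] at e1 e2
    rw [e1, e2, ← mul_sub, norm_mul, Padic.norm_p_zpow]
    have hpos : (0 : ℝ) < (p : ℝ) ^ (-l) := by positivity
    exact mul_lt_of_lt_one_right hpos (h1.trans_lt (inv_lt_one_of_one_lt₀ hp1))
  have h2 := aux_two hp
  have h2ne : (2 : ℚ_[p]) ≠ 0 := by
    rw [← norm_pos_iff, h2]; exact one_pos
  rw [Set.disjoint_left]
  rintro _ ⟨⟨u, v⟩, ⟨-, hv⟩, rfl⟩ ⟨⟨u', v'⟩, ⟨-, hv'⟩, he⟩
  simp only [Prod.mk.injEq] at he hv hv'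
  obtain ⟨ha, hb⟩ := he
  have ha' := (div_left_inj' h2ne).1 ha
  have hb' := (div_left_inj' h2ne).1 hb
  have hsum : s v + s v' = 0 := by
    have : (2 : ℚ_[p]) * (s v + s v') = 0 := by linear_combination hb' - ha'
    exact (mul_eq_zero.1 this).resolve_left h2ne
  have hfin : ‖(s v - s v₀) + (s v' - s v₀)‖ < (p : ℝ) ^ (-l) :=
    (Padic.nonarchimedean _ _).trans_lt (max_lt (key v hv) (key v' hv'))
  have heq : (s v - s v₀) + (s v' - s v₀) = -(2 * s v₀) := by linear_combination hsum
  rw [heq, norm_neg, norm_mul, h2, one_mul, hl] at hfin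
  exact lt_irrefl _ hfin
end

section
/- Let p > 2 be prime, 𝔰 the continuous square-root function of Lemma 3, and S₁(u, v) = ((u + 𝔰(v))/2, (u − 𝔰(v))/2). Let (u₀, v₀) ∈ ℚ_p × ℚ_p^{[2]} with |𝔰(v₀)|_p = p^{−l}, set (x₀, y₀) = S₁(u₀, v₀), and let E_k = (u₀, v₀) + (p^k ℤ_p) × (p^{k+l} ℤ_p). Then for every k ≥ l + 1, S₁(E_k) = (x₀, y₀) + (p^k ℤ_p)², and S₁ restricted to E_k and T(x,y) = (x+y, (x−y)²) restricted to S₁(E_k) are mutually inverse homeomorphisms. -/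
theorem aux_one_add_sq (p : ℕ) [Fact p.Prime] (h2 : ‖(2 : ℚ_[p])‖ = 1) (a : ℚ_[p])
    (ha : ‖a - 1‖ < 1) : ∃ t : ℚ_[p], a = t ^ 2 := by
  have ha1 : ‖a‖ ≤ 1 := by
    have := Padic.nonarchimedean (a - 1) 1
    rw [sub_add_cancel, norm_one] at this
    exact this.trans (max_le ha.le le_rfl)
  let b : ℤ_[p] := ⟨a, ha1⟩
  have h := hensels_lemma (p := p) (R := ℤ_[p])
    (F := (Polynomial.X ^ 2 - Polynomial.C b : Polynomial ℤ_[p])) (a := 1) (by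
      have e1 : ‖(1 : ℤ_[p]) - b‖ < 1 := by
        rw [PadicInt.norm_def]
        push_cast
        rw [norm_sub_rev]
        exact ha
      have e2 : ‖(2 : ℤ_[p])‖ = 1 := by
        rw [PadicInt.norm_def]
        exact_mod_cast h2
      simpa [e2, one_add_one_eq_two] using e1)
  obtain ⟨z, hz, -⟩ := h
  refine ⟨z, ?_⟩
  have hz' : z ^ 2 - b = 0 := by simpa using hz
  have := congrArg (fun x : ℤ_[p] => (x : ℚ_[p])) (sub_eq_zero.mp hz')
  simpa using this.symm

/-- Let `p > 2` be prime, `𝔰` the continuous square-root function of Lemma 3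
(so `𝔰(x)² = x` on squares, `𝔰(p^{2l}c) = p^l 𝔰(c)` for square units `c`, and `𝔰` maps each
ball of square units into a fixed coset of `pℤ_p`), and
`S₁(u, v) = ((u + 𝔰(v))/2, (u - 𝔰(v))/2)`, `T(x, y) = (x + y, (x - y)²)`.
Let `(u₀, v₀) ∈ ℚ_p × ℚ_p^{[2]}` with `|𝔰(v₀)|_p = p^{-l}`, `(x₀, y₀) = S₁(u₀, v₀)` and
`E_k = (u₀, v₀) + (p^k ℤ_p) × (p^{k+l} ℤ_p)`. Then for every `k ≥ l + 1`,
`S₁(E_k) = (x₀, y₀) + (p^k ℤ_p)²`, and `S₁` restricted to `E_k` and `T` restricted to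
`S₁(E_k)` are mutually inverse homeomorphisms. -/
theorem S1_image_eq_ball_and_inverse_homeo (p : ℕ) [Fact p.Prime] (hp : 2 < p)
    (s : ℚ_[p] → ℚ_[p])
    (hs_cont : ContinuousOn s {x : ℚ_[p] | ∃ t : ℚ_[p], x = t ^ 2})
    (hs_sq : ∀ x : ℚ_[p], (∃ t : ℚ_[p], x = t ^ 2) → (s x) ^ 2 = x)
    (hs_scale : ∀ (l : ℤ) (c : ℚ_[p]), ‖c‖ = 1 → (∃ t : ℚ_[p], c = t ^ 2) →
      s ((p : ℚ_[p]) ^ (2 * l) * c) = (p : ℚ_[p]) ^ l * s c)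
    (hs_coset : ∀ c v : ℚ_[p], ‖c‖ = 1 → (∃ t : ℚ_[p], c = t ^ 2) →
      (∃ t : ℚ_[p], v = t ^ 2) → ‖v - c‖ ≤ (p : ℝ)⁻¹ → ‖s v - s c‖ ≤ (p : ℝ)⁻¹)
    (u₀ v₀ : ℚ_[p]) (hv₀ : ∃ t : ℚ_[p], v₀ = t ^ 2)
    (l : ℤ) (hl : ‖s v₀‖ = (p : ℝ) ^ (-l))
    (k : ℤ) (hk : l + 1 ≤ k)
    (S₁ : ℚ_[p] × ℚ_[p] → ℚ_[p] × ℚ_[p])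
    (hS₁ : S₁ = fun q => ((q.1 + s q.2) / 2, (q.1 - s q.2) / 2))
    (T : ℚ_[p] × ℚ_[p] → ℚ_[p] × ℚ_[p])
    (hT : T = fun q => (q.1 + q.2, (q.1 - q.2) ^ 2))
    (Ek : Set (ℚ_[p] × ℚ_[p]))
    (hEk : Ek = {q : ℚ_[p] × ℚ_[p] |
      ‖q.1 - u₀‖ ≤ (p : ℝ) ^ (-k) ∧ ‖q.2 - v₀‖ ≤ (p : ℝ) ^ (-(k + l))}) :
    S₁ '' Ek = {q : ℚ_[p] × ℚ_[p] |
        ‖q.1 - (u₀ + s v₀) / 2‖ ≤ (p : ℝ) ^ (-k) ∧ ‖q.2 - (u₀ - s v₀) / 2‖ ≤ (p : ℝ) ^ (-k)} ∧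
      (∀ q ∈ Ek, T (S₁ q) = q) ∧
      (∀ q ∈ S₁ '' Ek, S₁ (T q) = q) ∧
      ContinuousOn S₁ Ek ∧
      ContinuousOn T (S₁ '' Ek) := by
  have hp0 : (0 : ℝ) < p := by positivity
  have hp1 : (1 : ℝ) < p := by exact_mod_cast (by omega : 1 < p)
  have hpp : (p : ℚ_[p]) ≠ 0 := by exact_mod_cast (by omega : p ≠ 0)
  have h20 : (2 : ℚ_[p]) ≠ 0 := two_ne_zero
  have h2 : ‖(2 : ℚ_[p])‖ = 1 := by
    have := (Padic.norm_natCast_eq_one_iff (p := p) (n := 2)).2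
      ((Nat.coprime_primes Fact.out Nat.prime_two).2 (by omega))
    exact_mod_cast this
  set σ := s v₀ with hσ
  have hσ2 : σ ^ 2 = v₀ := hs_sq v₀ hv₀
  have hσ0 : σ ≠ 0 := by
    rw [← norm_pos_iff, hl]; positivity
  have hlt : (p : ℝ) ^ (-(l + 1)) < (p : ℝ) ^ (-l) :=
    zpow_lt_zpow_right₀ hp1 (by omega)
  have hkl : (p : ℝ) ^ (-k) ≤ (p : ℝ) ^ (-(l + 1)) :=
    zpow_le_zpow_right₀ hp1.le (by omega)
  have hplus : ∀ w : ℚ_[p], ‖w - σ‖ ≤ (p : ℝ) ^ (-(l + 1)) → ‖w + σ‖ = (p : ℝ) ^ (-l) := by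
    intro w hw
    have h2σ : ‖2 * σ‖ = (p : ℝ) ^ (-l) := by rw [norm_mul, h2, one_mul, hl]
    have hne : ‖w - σ‖ ≠ ‖2 * σ‖ := by rw [h2σ]; exact (hw.trans_lt hlt).ne
    have := Padic.add_eq_max_of_ne hne
    rw [h2σ, max_eq_right (hw.trans hlt.le)] at this
    rw [← this]; congr 1; ring
  have key : ∀ v : ℚ_[p], ‖v - v₀‖ ≤ (p : ℝ) ^ (-(k + l)) →
      (∃ t : ℚ_[p], v = t ^ 2) ∧ ‖s v - σ‖ ≤ (p : ℝ) ^ (-k) := by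
    intro v hv
    have hv1 : ‖v - v₀‖ ≤ (p : ℝ) ^ (-(2 * l) - 1) :=
      hv.trans (zpow_le_zpow_right₀ hp1.le (by omega))
    have hpn : ‖(p : ℚ_[p]) ^ (2 * l)‖ = (p : ℝ) ^ (-(2 * l)) := Padic.norm_p_zpow _
    have hpl : ‖(p : ℚ_[p]) ^ l‖ = (p : ℝ) ^ (-l) := Padic.norm_p_zpow _
    have hv0n : ‖v₀‖ = (p : ℝ) ^ (-(2 * l)) := by
      rw [← hσ2, norm_pow, hl, ← zpow_natCast, ← zpow_mul]; congr 1; push_cast; ring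
    have hv00 : v₀ ≠ 0 := by rw [← hσ2]; exact pow_ne_zero _ hσ0
    have hdiv : ∀ x : ℚ_[p], ‖x‖ = (p : ℝ) ^ (-(2 * l)) → ‖(v - v₀) / x‖ ≤ (p : ℝ)⁻¹ := by
      intro x hx
      rw [norm_div, hx, div_le_iff₀ (by positivity)]
      refine hv1.trans (le_of_eq ?_)
      rw [zpow_sub_one₀ hp0.ne', mul_comm]
    have hinv : (p : ℝ)⁻¹ < 1 := inv_lt_one_of_one_lt₀ hp1
    have hvsq : ∃ t : ℚ_[p], v = t ^ 2 := by
      obtain ⟨t, ht⟩ := aux_one_add_sq p h2 (v / v₀) (by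
        have : v / v₀ - 1 = (v - v₀) / v₀ := by field_simp
        rw [this]; exact (hdiv v₀ hv0n).trans_lt hinv)
      refine ⟨σ * t, ?_⟩
      rw [mul_pow, hσ2, ← ht]; field_simp
    refine ⟨hvsq, ?_⟩
    have hP : (p : ℚ_[p]) ^ (2 * l) = ((p : ℚ_[p]) ^ l) ^ 2 := by
      rw [← zpow_natCast, ← zpow_mul]; congr 1; push_cast; ring
    have hP0 : (p : ℚ_[p]) ^ (2 * l) ≠ 0 := zpow_ne_zero _ hpp
    have hsqdiv : ∀ x : ℚ_[p], (∃ t : ℚ_[p], x = t ^ 2) →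
        ∃ t : ℚ_[p], x / (p : ℚ_[p]) ^ (2 * l) = t ^ 2 := by
      rintro x ⟨t, rfl⟩
      exact ⟨t / (p : ℚ_[p]) ^ l, by rw [hP, div_pow]⟩
    have hvn : ‖v‖ = (p : ℝ) ^ (-(2 * l)) := by
      have hlt2 : ‖v - v₀‖ < ‖v₀‖ := by
        rw [hv0n]; exact hv1.trans_lt (zpow_lt_zpow_right₀ hp1 (by omega))
      have := Padic.add_eq_max_of_ne hlt2.ne
      rw [sub_add_cancel, max_eq_right hlt2.le] at this
      rw [this, hv0n]
    have hc : ‖v₀ / (p : ℚ_[p]) ^ (2 * l)‖ = 1 := by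
      rw [norm_div, hv0n, hpn, div_self (by positivity)]
    have hc' : ‖v / (p : ℚ_[p]) ^ (2 * l)‖ = 1 := by
      rw [norm_div, hvn, hpn, div_self (by positivity)]
    have hco := hs_coset _ _ hc (hsqdiv _ hv₀) (hsqdiv _ hvsq) (by
      rw [← sub_div]; exact hdiv _ hpn)
    have e1 := hs_scale l _ hc (hsqdiv _ hv₀)
    have e2 := hs_scale l _ hc' (hsqdiv _ hvsq)
    rw [mul_div_cancel₀ _ hP0] at e1 e2
    have hrough : ‖s v - σ‖ ≤ (p : ℝ) ^ (-(l + 1)) := by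
      rw [hσ, e1, e2, ← mul_sub, norm_mul, hpl]
      have : (p : ℝ) ^ (-(l + 1)) = (p : ℝ) ^ (-l) * (p : ℝ)⁻¹ := by
        rw [← zpow_sub_one₀ hp0.ne']; congr 1; ring
      rw [this]
      gcongr
    have hs := hplus _ hrough
    have hprod : ‖s v - σ‖ * (p : ℝ) ^ (-l) ≤ (p : ℝ) ^ (-k) * (p : ℝ) ^ (-l) := by
      rw [← hs, ← norm_mul, hs, ← zpow_add₀ hp0.ne']
      have : (s v - σ) * (s v + σ) = v - v₀ := by
        rw [← hσ2, ← hs_sq v hvsq]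
        rw [hs_sq v hvsq]; linear_combination hs_sq v hvsq
      rw [this]
      refine hv.trans (le_of_eq ?_)
      congr 1; ring
    exact le_of_mul_le_mul_right hprod (by positivity)
  have conv : ∀ w : ℚ_[p], ‖w - σ‖ ≤ (p : ℝ) ^ (-k) →
      ‖w ^ 2 - v₀‖ ≤ (p : ℝ) ^ (-(k + l)) ∧ s (w ^ 2) = w := by
    intro w hw
    have hw' := hplus w (hw.trans hkl)
    have hb : ‖w ^ 2 - v₀‖ ≤ (p : ℝ) ^ (-(k + l)) := by
      have : w ^ 2 - v₀ = (w - σ) * (w + σ) := by rw [← hσ2]; ring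
      rw [this, norm_mul, hw', neg_add, zpow_add₀ hp0.ne']
      gcongr
    refine ⟨hb, ?_⟩
    obtain ⟨hsq, hs⟩ := key _ hb
    rcases sq_eq_sq_iff_eq_or_eq_neg.mp (hs_sq _ hsq) with h | h
    · exact h
    · exfalso
      rw [h, ← neg_add', norm_neg, hw'] at hs
      exact absurd (hs.trans hkl) (not_le.mpr hlt)
  have hhalf : ∀ a b : ℚ_[p], ‖a‖ ≤ (p : ℝ) ^ (-k) → ‖b‖ ≤ (p : ℝ) ^ (-k) →
      ‖a + b‖ ≤ (p : ℝ) ^ (-k) ∧ ‖a - b‖ ≤ (p : ℝ) ^ (-k) := by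
    intro a b ha hb
    refine ⟨(Padic.nonarchimedean a b).trans (max_le ha hb), ?_⟩
    rw [sub_eq_add_neg]
    exact (Padic.nonarchimedean a (-b)).trans (max_le ha (by rwa [norm_neg]))
  have hTS : ∀ q ∈ Ek, T (S₁ q) = q := by
    intro q hq
    rw [hEk] at hq
    have := hs_sq _ (key q.2 hq.2).1
    rw [hS₁, hT]
    refine Prod.ext ?_ ?_
    · simp only; ring
    · simp only; linear_combination this
  have himg : S₁ '' Ek = {q : ℚ_[p] × ℚ_[p] |
        ‖q.1 - (u₀ + σ) / 2‖ ≤ (p : ℝ) ^ (-k) ∧ ‖q.2 - (u₀ - σ) / 2‖ ≤ (p : ℝ) ^ (-k)} := by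
    ext q
    simp only [Set.mem_image, Set.mem_ofPred_eq]
    constructor
    · rintro ⟨r, hr, rfl⟩
      rw [hEk] at hr
      obtain ⟨h1, h3⟩ := hhalf _ _ hr.1 (key r.2 hr.2).2
      rw [hS₁]
      simp only
      constructor
      · have : (r.1 + s r.2) / 2 - (u₀ + σ) / 2 = ((r.1 - u₀) + (s r.2 - σ)) / 2 := by ring
        rw [this, norm_div, h2, div_one]; exact h1
      · have : (r.1 - s r.2) / 2 - (u₀ - σ) / 2 = ((r.1 - u₀) - (s r.2 - σ)) / 2 := by ring
        rw [this, norm_div, h2, div_one]; exact h3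
    · rintro ⟨h1, h3⟩
      obtain ⟨h4, h5⟩ := hhalf _ _ h1 h3
      obtain ⟨h6, h7⟩ := conv (q.1 - q.2) (by
        convert h5 using 2; ring)
      refine ⟨(q.1 + q.2, (q.1 - q.2) ^ 2), ?_, ?_⟩
      · rw [hEk]
        refine ⟨?_, h6⟩
        simp only
        convert h4 using 2; ring
      · rw [hS₁]
        simp only [h7]
        refine Prod.ext ?_ ?_
        · simp only; ring
        · simp only; ring
  refine ⟨himg, hTS, ?_, ?_, ?_⟩
  · rintro _ ⟨r, hr, rfl⟩
    rw [hTS r hr]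
  · have hc : ContinuousOn (fun q : ℚ_[p] × ℚ_[p] => s q.2) Ek :=
      hs_cont.comp continuous_snd.continuousOn (by
        intro q hq
        rw [hEk] at hq
        exact (key q.2 hq.2).1)
    rw [hS₁]
    exact ((continuous_fst.continuousOn.add hc).div_const 2).prodMk
      ((continuous_fst.continuousOn.sub hc).div_const 2)
  · rw [hT]
    fun_prop
end

section
/- Let p > 2 be prime. Let ξ and η be independent identically distributed random variables with values in ℚ_p whose common distribution μ has a continuous density ρ with respect to the Haar measure m on ℚ_p (normalized so m(ℤ_p) = 1). Then (without assuming independence of S and D) the distribution of the pair (S, D) = (ξ + η, (ξ − η)²) is absolutely continuous with respect to the Haar measure on ℚ_p², with density equal to 2·ρ((u + 𝔰(v))/2)·ρ((u − 𝔰(v))/2)·|𝔰(v)|_p^{−1} at points (u, v) with v ∈ ℚ_p^{[2]} \ {0}, and equal to 0 at points (u, v) with v ∉ ℚ_p^{[2]} \ {0}. -/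
open MeasureTheory ProbabilityTheory

set_option linter.unusedSectionVars false

namespace SD

variable {p : ℕ} [hpf : Fact p.Prime] [MeasurableSpace ℚ_[p]] [BorelSpace ℚ_[p]]

lemma union_cosets (x : ℚ_[p]) (hx : ‖x‖ ≤ 1) : ∃ i, i < p ∧ ‖x - (i : ℚ_[p])‖ < 1 := by
  obtain ⟨n, hn, hx2⟩ := PadicInt.exists_mem_range (⟨x, hx⟩ : ℤ_[p])
  refine ⟨n, hn, ?_⟩
  rw [IsLocalRing.mem_maximalIdeal, PadicInt.mem_nonunits] at hx2
  rw [PadicInt.norm_def] at hx2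
  push_cast at hx2
  exact hx2

lemma coset_unique (x : ℚ_[p]) (hx : ‖x‖ ≤ 1) (i j : ℕ) (hi : i < p) (hj : j < p)
    (h1 : ‖x - (i : ℚ_[p])‖ < 1) (h2 : ‖x - (j : ℚ_[p])‖ < 1) : i = j := by
  refine (PadicInt.existsUnique_mem_range (⟨x, hx⟩ : ℤ_[p])).unique ⟨hi, ?_⟩ ⟨hj, ?_⟩
  · rw [IsLocalRing.mem_maximalIdeal, PadicInt.mem_nonunits]
    rw [PadicInt.norm_def]
    push_cast
    exact h1
  · rw [IsLocalRing.mem_maximalIdeal, PadicInt.mem_nonunits]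
    rw [PadicInt.norm_def]
    push_cast
    exact h2

lemma le_one_of_coset (x : ℚ_[p]) (i : ℕ) (h1 : ‖x - (i : ℚ_[p])‖ < 1) : ‖x‖ ≤ 1 := by
  have := IsUltrametricDist.norm_add_le_max (x - (i : ℚ_[p])) (i : ℚ_[p])
  rw [sub_add_cancel] at this
  refine this.trans (max_le h1.le ?_)
  have := Padic.norm_int_le_one (p := p) (i : ℤ)
  simpa using this

lemma meas_open_ball (m : Measure ℚ_[p]) [m.IsAddHaarMeasure]
    (hm : m {x : ℚ_[p] | ‖x‖ ≤ 1} = 1) : (p : ENNReal) * m {x : ℚ_[p] | ‖x‖ < 1} = 1 := by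
  have e : {x : ℚ_[p] | ‖x‖ ≤ 1} =
      ⋃ i ∈ Finset.range p, {x : ℚ_[p] | ‖x - (i : ℚ_[p])‖ < 1} := by
    ext x
    simp only [Set.mem_ofPred_eq, Set.mem_iUnion, Finset.mem_range, exists_prop]
    exact ⟨union_cosets x, fun ⟨i, _, h⟩ => le_one_of_coset x i h⟩
  rw [← hm, e, measure_biUnion_finset]
  · have : ∀ i ∈ Finset.range p, m {x : ℚ_[p] | ‖x - (i : ℚ_[p])‖ < 1} =
        m {x : ℚ_[p] | ‖x‖ < 1} := by
      intro i _
      rw [← measure_preimage_add m (-(i : ℚ_[p])) {x : ℚ_[p] | ‖x‖ < 1}]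
      congr 1
      ext x
      simp [sub_eq_neg_add]
    rw [Finset.sum_congr rfl this]
    simp
  · intro i hi j hj hij
    refine Set.disjoint_left.2 fun x h1 h2 => hij ?_
    simp at hi hj
    exact coset_unique x (le_one_of_coset x i h1) i j hi hj h1 h2
  · intro i _
    exact (isOpen_lt (by fun_prop) continuous_const).measurableSet

lemma scale_exists (m : Measure ℚ_[p]) [m.IsAddHaarMeasure] (c : ℚ_[p]) (hc : c ≠ 0) :
    ∃ k : ENNReal, Measure.map (fun x => c * x) m = k • m := by
  have : (Measure.map (fun x => c * x) m).IsAddHaarMeasure :=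
    ContinuousLinearEquiv.isAddHaarMeasure_map
      (ContinuousLinearEquiv.smulLeft (R₁ := ℚ_[p]) (M₁ := ℚ_[p]) (Units.mk0 c hc)) m
  exact ⟨_, Measure.isAddLeftInvariant_eq_smul _ m⟩

lemma scale_unit (m : Measure ℚ_[p]) [m.IsAddHaarMeasure]
    (hm : m {x : ℚ_[p] | ‖x‖ ≤ 1} = 1) (c : ℚ_[p]) (hc : ‖c‖ = 1) :
    Measure.map (fun x => c * x) m = m := by
  obtain ⟨k, hk⟩ := scale_exists m c (by rintro rfl; simp at hc)
  have h := congrArg (fun μ => μ {x : ℚ_[p] | ‖x‖ ≤ 1}) hk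
  simp only [Measure.smul_apply, hm] at h
  rw [Measure.map_apply (by fun_prop) (isClosed_le (by fun_prop) continuous_const).measurableSet]
    at h
  simp [hc, hm] at h
  rw [hk, ← h, one_smul]

lemma scale_p (m : Measure ℚ_[p]) [m.IsAddHaarMeasure]
    (hm : m {x : ℚ_[p] | ‖x‖ ≤ 1} = 1) :
    Measure.map (fun x => (p : ℚ_[p]) * x) m = (p : ENNReal) • m := by
  obtain ⟨k, hk⟩ := scale_exists m (p : ℚ_[p]) (by exact_mod_cast hpf.out.ne_zero)
  have h := congrArg (fun μ => μ {x : ℚ_[p] | ‖x‖ < 1}) hk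
  simp only [Measure.smul_apply] at h
  rw [Measure.map_apply (by fun_prop) (isOpen_lt (by fun_prop) continuous_const).measurableSet]
    at h
  have e : (fun x => (p : ℚ_[p]) * x) ⁻¹' {x : ℚ_[p] | ‖x‖ < 1} = {x : ℚ_[p] | ‖x‖ ≤ 1} := by
    ext x
    simp only [Set.mem_preimage, Set.mem_ofPred_eq, norm_mul, Padic.norm_p]
    have hp1 : (1 : ℝ) < p := by exact_mod_cast hpf.out.one_lt
    have hp0 : (0 : ℝ) < p := by linarith
    rw [inv_mul_lt_iff₀ hp0, mul_one]
    have := Padic.norm_le_pow_iff_norm_lt_pow_add_one x 0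
    simpa using this.symm
  rw [e, hm] at h
  have h2 := meas_open_ball m hm
  set B := m {x : ℚ_[p] | ‖x‖ < 1}
  have hB0 : B ≠ 0 := by intro h0; simp [h0] at h2
  have hBt : B ≠ ⊤ := by
    intro h0
    rw [h0, ENNReal.mul_top (by exact_mod_cast hpf.out.ne_zero)] at h2
    simp at h2
  have : k = p := by
    have h3 : k * B = p * B := by rw [h2]; exact h.symm
    exact (ENNReal.mul_left_inj hB0 hBt).1 h3
  rw [hk, this]

lemma scale_mul (m : Measure ℚ_[p]) (c d : ℚ_[p]) (k l : ENNReal)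
    (h1 : Measure.map (fun x => c * x) m = k • m) (h2 : Measure.map (fun x => d * x) m = l • m) :
    Measure.map (fun x => (c * d) * x) m = (k * l) • m := by
  have : (fun x => (c * d) * x) = (fun x => c * x) ∘ (fun x => d * x) := by
    ext x; simp [mul_assoc]
  rw [this, ← Measure.map_map (by fun_prop) (by fun_prop), h2, Measure.map_smul, h1, smul_smul,
    mul_comm]

lemma scale_pow (m : Measure ℚ_[p]) [m.IsAddHaarMeasure]
    (hm : m {x : ℚ_[p] | ‖x‖ ≤ 1} = 1) (n : ℕ) :
    Measure.map (fun x => ((p : ℚ_[p]) ^ n) * x) m = ((p : ENNReal) ^ n) • m := by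
  induction n with
  | zero => simp
  | succ n ih => 
    rw [pow_succ, pow_succ]
    exact scale_mul m _ _ _ _ ih (scale_p m hm)

lemma scale_inv (m : Measure ℚ_[p]) (c : ℚ_[p]) (hc : c ≠ 0) (k : ENNReal) (hk : k ≠ 0)
    (hk' : k ≠ ⊤)
    (h1 : Measure.map (fun x => c * x) m = k • m) :
    Measure.map (fun x => c⁻¹ * x) m = k⁻¹ • m := by
  have h2 := congrArg (Measure.map (fun x => c⁻¹ * x)) h1
  rw [Measure.map_map (by fun_prop) (by fun_prop), Measure.map_smul] at h2
  have : ((fun x => c⁻¹ * x) ∘ fun x => c * x) = id := by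
    ext x; simp [hc]
  rw [this, Measure.map_id] at h2
  nth_rw 2 [h2]
  rw [smul_smul, ENNReal.inv_mul_cancel hk hk', one_smul]

lemma scale (m : Measure ℚ_[p]) [m.IsAddHaarMeasure]
    (hm : m {x : ℚ_[p] | ‖x‖ ≤ 1} = 1) (c : ℚ_[p]) (hc : c ≠ 0) :
    Measure.map (fun x => c * x) m = ENNReal.ofReal (‖c‖⁻¹) • m := by
  have hp0 : (p : ℚ_[p]) ≠ 0 := by exact_mod_cast hpf.out.ne_zero
  have hp1 : (0 : ℝ) < p := by exact_mod_cast hpf.out.pos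
  have key : ∀ n : ℤ, Measure.map (fun x => ((p : ℚ_[p]) ^ n) * x) m =
      ENNReal.ofReal ((p : ℝ) ^ n) • m := by
    intro n
    have h0 : ∀ n : ℕ, ENNReal.ofReal ((p : ℝ) ^ n) = (p : ENNReal) ^ n := by
      intro n
      rw [ENNReal.ofReal_pow hp1.le, ENNReal.ofReal_natCast]
    obtain ⟨n, rfl | rfl⟩ := n.eq_nat_or_neg
    · rw [zpow_natCast, zpow_natCast, h0]
      exact scale_pow m hm n
    · rw [zpow_neg, zpow_neg, zpow_natCast, zpow_natCast, ENNReal.ofReal_inv_of_pos (by positivity),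
        h0]
      refine scale_inv m _ (pow_ne_zero _ hp0) _ ?_ ?_ (scale_pow m hm n)
      · exact pow_ne_zero _ (by exact_mod_cast hpf.out.ne_zero)
      · exact ENNReal.pow_ne_top (by simp)
  have e : c = (p : ℚ_[p]) ^ c.valuation * (c * ((p : ℚ_[p]) ^ c.valuation)⁻¹) := by
    field_simp
  have hu : ‖c * ((p : ℚ_[p]) ^ c.valuation)⁻¹‖ = 1 := by
    rw [norm_mul, norm_inv, norm_zpow, Padic.norm_p, Padic.norm_eq_zpow_neg_valuation hc,
      inv_zpow, zpow_neg, inv_inv, inv_mul_cancel₀ (by positivity)]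
  have h2 := scale_mul m _ _ _ _ (key c.valuation) ((scale_unit m hm _ hu).trans (one_smul ENNReal m).symm)
  rw [← e, mul_one] at h2
  rw [h2, Padic.norm_eq_zpow_neg_valuation hc, zpow_neg, inv_inv]

lemma meas_ball (m : Measure ℚ_[p]) [m.IsAddHaarMeasure]
    (hm : m {x : ℚ_[p] | ‖x‖ ≤ 1} = 1) (a b : ℚ_[p]) (hb : b ≠ 0) (r : ℝ) :
    m (Metric.ball a (r / ‖b‖)) = ENNReal.ofReal (‖b‖⁻¹) * m (Metric.ball (b * a) r) := by
  have h := congrArg (fun μ => μ (Metric.ball (b * a) r)) (scale m hm b hb)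
  simp only [Measure.smul_apply, smul_eq_mul] at h
  rw [← h, Measure.map_apply (by fun_prop) measurableSet_ball]
  congr 1
  ext x
  have : 0 < ‖b‖ := norm_pos_iff.2 hb
  simp only [Metric.mem_ball, Set.mem_preimage, dist_eq_norm, ← mul_sub, norm_mul]
  rw [lt_div_iff₀ this, mul_comm]

lemma ball_translate (m : Measure ℚ_[p]) [m.IsAddHaarMeasure] (a b : ℚ_[p]) (r : ℝ) :
    m (Metric.ball a r) = m (Metric.ball b r) := by
  rw [← measure_preimage_add m (a - b) (Metric.ball a r)]
  congr 1
  ext x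
  simp only [Metric.mem_ball, Set.mem_preimage, dist_eq_norm]
  rw [show a - b + x - a = x - b by ring]

lemma norm_two (hp : 2 < p) : ‖(2 : ℚ_[p])‖ = 1 := by
  have h := Padic.norm_natCast_eq_one_iff (p := p) (n := 2)
  have : p.Coprime 2 := by
    rw [Nat.coprime_primes hpf.out Nat.prime_two]; omega
  exact_mod_cast h.2 this

lemma hensel_one (hp : 2 < p) (x : ℚ_[p]) (hx : ‖x - 1‖ < 1) : ∃ t : ℚ_[p], x = t ^ 2 := by
  have hx1 : ‖x‖ ≤ 1 := le_one_of_coset x 1 (by simpa using hx)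
  let y : ℤ_[p] := ⟨x, hx1⟩
  have h2 : ‖(2 : ℤ_[p])‖ = 1 := by
    rw [PadicInt.norm_def]
    exact_mod_cast norm_two hp
  have hy : ‖y - 1‖ < 1 := by
    rw [PadicInt.norm_def]
    push_cast
    exact hx
  obtain ⟨z, hz, -⟩ := hensels_lemma (p := p) (R := ℤ_[p])
    (F := Polynomial.X ^ 2 - Polynomial.C y) (a := 1) (by
      simp
      rw [norm_sub_rev, one_add_one_eq_two, h2, one_pow]
      exact hy)
  refine ⟨z, ?_⟩
  simp [sub_eq_zero] at hz
  have := congrArg (fun t : ℤ_[p] => (t : ℚ_[p])) hz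
  simpa [y] using this.symm

lemma sq_of_near (hp : 2 < p) (a v : ℚ_[p]) (ha : a ≠ 0) (h : ‖v - a ^ 2‖ < ‖a ^ 2‖) :
    ∃ t : ℚ_[p], v = t ^ 2 := by
  have ha2 : a ^ 2 ≠ 0 := pow_ne_zero _ ha
  obtain ⟨t, ht⟩ := hensel_one hp (v / a ^ 2) (by
    rw [show v / a ^ 2 - 1 = (v - a ^ 2) / a ^ 2 by field_simp, norm_div,
      div_lt_one (norm_pos_iff.2 ha2)]
    exact h)
  refine ⟨t * a, ?_⟩
  rw [mul_pow, ← ht]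
  field_simp

lemma norm_eq_of_near (a b : ℚ_[p]) (h : ‖a - b‖ < ‖b‖) : ‖a‖ = ‖b‖ := by
  have h2 := IsUltrametricDist.norm_add_eq_max_of_norm_ne_norm (x := a - b) (y := b) h.ne
  rwa [sub_add_cancel, max_eq_right h.le] at h2

lemma norm_add_of_near (hp : 2 < p) (w a : ℚ_[p]) (h : ‖w - a‖ < ‖a‖) : ‖w + a‖ = ‖a‖ := by
  have := norm_eq_of_near (w + a) (2 * a) (by
    rw [norm_mul, norm_two hp, one_mul]
    rwa [show w + a - 2 * a = w - a by ring])
  rw [this, norm_mul, norm_two hp, one_mul]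

lemma sq_preimage (hp : 2 < p) (a : ℚ_[p]) (ha : a ≠ 0) (r : ℝ) (hr : r ≤ ‖a ^ 2‖) :
    (fun w : ℚ_[p] => w ^ 2) ⁻¹' (Metric.ball (a ^ 2) r) =
      Metric.ball a (r / ‖a‖) ∪ Metric.ball (-a) (r / ‖a‖) := by
  have ha0 : 0 < ‖a‖ := norm_pos_iff.2 ha
  rw [norm_pow] at hr
  have hr' : r / ‖a‖ ≤ ‖a‖ := by rw [div_le_iff₀ ha0]; nlinarith
  ext w
  simp only [Metric.mem_ball, Set.mem_preimage, dist_eq_norm, Set.mem_union, sub_neg_eq_add]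
  rw [show w ^ 2 - a ^ 2 = (w - a) * (w + a) by ring, norm_mul]
  constructor
  · intro h
    by_cases h1 : ‖w - a‖ < ‖a‖
    · left
      rw [norm_add_of_near hp w a h1] at h
      rwa [lt_div_iff₀ ha0]
    · by_cases h2 : ‖w + a‖ < ‖a‖
      · right
        have := norm_add_of_near hp w (-a) (by simpa using h2)
        rw [← sub_eq_add_neg, norm_neg] at this
        rw [this] at h
        rwa [lt_div_iff₀ ha0, mul_comm]
      · push Not at h1 h2
        have := mul_le_mul h1 h2 ha0.le (norm_nonneg _)
        nlinarith
  · rintro (h | h)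
    · rw [norm_add_of_near hp w a (h.trans_le hr')]
      rwa [lt_div_iff₀ ha0] at h
    · have := norm_add_of_near hp w (-a) (by simpa using h.trans_le hr')
      rw [← sub_eq_add_neg, norm_neg] at this
      rw [this, mul_comm]
      rwa [lt_div_iff₀ ha0] at h

lemma disj (hp : 2 < p) (a : ℚ_[p]) (r : ℝ) (hr : r ≤ ‖a‖) :
    Disjoint (Metric.ball a r) (Metric.ball (-a) r) := by
  refine Set.disjoint_left.2 fun w h1 h2 => ?_
  simp only [Metric.mem_ball, dist_eq_norm, sub_neg_eq_add] at h1 h2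
  rw [norm_add_of_near hp w a (h1.trans_le hr)] at h2
  linarith

/-- nonzero squares -/
def NS (p : ℕ) [Fact p.Prime] : Set ℚ_[p] := {v | (∃ t : ℚ_[p], v = t ^ 2) ∧ v ≠ 0}

lemma NS_near (hp : 2 < p) (v w : ℚ_[p]) (hv : v ∈ NS p) (h : ‖w - v‖ < ‖v‖) : w ∈ NS p := by
  obtain ⟨⟨a, rfl⟩, h0⟩ := hv
  refine ⟨sq_of_near hp a w (by rintro rfl; simp at h0) h, ?_⟩
  rintro rfl
  simp at h

lemma NS_open (hp : 2 < p) : IsOpen (NS p) := by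
  rw [Metric.isOpen_iff]
  intro v hv
  refine ⟨‖v‖, norm_pos_iff.2 hv.2, fun w hw => NS_near hp v w hv ?_⟩
  simpa [dist_eq_norm] using hw

/-- density of the square map -/
noncomputable def dens (p : ℕ) [Fact p.Prime] (s : ℚ_[p] → ℚ_[p]) : ℚ_[p] → ENNReal :=
  (NS p).indicator fun v => ENNReal.ofReal (2 * ‖s v‖⁻¹)

lemma ball_eq (hp : 2 < p) (m : Measure ℚ_[p]) [m.IsAddHaarMeasure]
    (hm : m {x : ℚ_[p] | ‖x‖ ≤ 1} = 1) (s : ℚ_[p] → ℚ_[p])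
    (hs_sq : ∀ x : ℚ_[p], (∃ t : ℚ_[p], x = t ^ 2) → (s x) ^ 2 = x)
    (b : ℚ_[p]) (hb : b ≠ 0) (r : ℝ) (hr : r ≤ ‖b‖) :
    Measure.map (fun w => w ^ 2) m (Metric.ball b r) =
      m.withDensity (dens p s) (Metric.ball b r) := by
  rw [Measure.map_apply (by fun_prop) measurableSet_ball, withDensity_apply _ measurableSet_ball]
  by_cases hbs : b ∈ NS p
  · obtain ⟨⟨a, rfl⟩, h0⟩ := hbs
    have ha : a ≠ 0 := by rintro rfl; simp at h0
    have ha0 : 0 < ‖a‖ := norm_pos_iff.2 ha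
    have hr' : r / ‖a‖ ≤ ‖a‖ := by rw [div_le_iff₀ ha0]; rw [norm_pow] at hr; nlinarith
    rw [sq_preimage hp a ha r hr, measure_union (disj hp a _ hr') measurableSet_ball,
      ball_translate m (-a) a, meas_ball m hm a a ha r, ← sq]
    have : ∀ v ∈ Metric.ball (a ^ 2) r, dens p s v = ENNReal.ofReal (2 * ‖a‖⁻¹) := by
      intro v hv
      have hv' : ‖v - a ^ 2‖ < ‖a ^ 2‖ := by
        rw [Metric.mem_ball, dist_eq_norm] at hv; exact hv.trans_le hr
      have hvN := NS_near hp (a ^ 2) v ⟨⟨a, rfl⟩, h0⟩ hv'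
      have h1 := hs_sq v hvN.1
      have h2 : ‖s v‖ = ‖a‖ := by
        have := norm_eq_of_near _ _ hv'
        rw [← h1, norm_pow, norm_pow] at this
        exact (pow_left_inj₀ (norm_nonneg _) (norm_nonneg _) two_ne_zero).1 this
      rw [dens, Set.indicator_of_mem hvN, h2]
    rw [setLIntegral_congr_fun measurableSet_ball this, setLIntegral_const,
      ENNReal.ofReal_mul (by norm_num), ← two_mul, ← mul_assoc]
    simp
  · have h1 : (fun w : ℚ_[p] => w ^ 2) ⁻¹' (Metric.ball b r) = ∅ := by
      refine Set.eq_empty_of_forall_notMem fun w hw => hbs ?_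
      simp only [Metric.mem_ball, Set.mem_preimage, dist_eq_norm] at hw
      have hw' := hw.trans_le hr
      have hn := norm_eq_of_near _ _ hw'
      refine NS_near hp (w ^ 2) b ⟨⟨w, rfl⟩, ?_⟩ ?_
      · intro h; rw [h] at hn; simp at hn; exact hb (norm_eq_zero.1 hn.symm)
      · rwa [hn, norm_sub_rev]
    have : ∀ v ∈ Metric.ball b r, dens p s v = 0 := by
      intro v hv
      refine Set.indicator_of_notMem (fun hvN => hbs ?_) _
      have hv' : ‖v - b‖ < ‖b‖ := by
        rw [Metric.mem_ball, dist_eq_norm] at hv; exact hv.trans_le hr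
      refine NS_near hp v b hvN ?_
      rwa [norm_eq_of_near _ _ hv', norm_sub_rev]
    rw [setLIntegral_congr_fun measurableSet_ball this, h1]
    simp

lemma map_sq (hp : 2 < p) (m : Measure ℚ_[p]) [m.IsAddHaarMeasure]
    (hm : m {x : ℚ_[p] | ‖x‖ ≤ 1} = 1) (s : ℚ_[p] → ℚ_[p])
    (hs_sq : ∀ x : ℚ_[p], (∃ t : ℚ_[p], x = t ^ 2) → (s x) ^ 2 = x) :
    Measure.map (fun w => w ^ 2) m = m.withDensity (dens p s) := by
  have hm0 : m {0} = 0 := measure_singleton 0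
  let S : ℚ → Set ℚ_[p] := fun q => if q = 0 then {0} else Metric.ball (q : ℚ_[p]) ‖(q : ℚ_[p])‖
  have hS : ⋃ q, S q = Set.univ := by
    refine Set.eq_univ_of_forall fun x => ?_
    rw [Set.mem_iUnion]
    by_cases hx : x = 0
    · exact ⟨0, by simp [S, hx]⟩
    · obtain ⟨q, hq⟩ := Padic.rat_dense p x (norm_pos_iff.2 hx)
      have hq0 : q ≠ 0 := by rintro rfl; simp at hq
      refine ⟨q, ?_⟩
      simp only [S, hq0, if_false, Metric.mem_ball, dist_eq_norm]
      rwa [norm_eq_of_near (q : ℚ_[p]) x (by rwa [norm_sub_rev])]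
  rw [Measure.ext_iff_of_iUnion_eq_univ hS]
  intro q
  by_cases hq : q = 0
  · have e : S q = {0} := by simp [S, hq]
    rw [e, Measure.restrict_eq_zero.2, Measure.restrict_eq_zero.2]
    · exact withDensity_absolutelyContinuous _ _ hm0
    · rw [Measure.map_apply (by fun_prop) (measurableSet_singleton _)]
      convert hm0
      ext x
      simp
  · have hq' : (q : ℚ_[p]) ≠ 0 := by exact_mod_cast hq
    have e : S q = Metric.ball (q : ℚ_[p]) ‖(q : ℚ_[p])‖ := by simp [S, hq]
    rw [e]
    set b : ℚ_[p] := (q : ℚ_[p])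
    have hbas : TopologicalSpace.IsTopologicalBasis
        ({t : Set ℚ_[p] | ∃ c r, t = Metric.ball c r}) := by
      refine TopologicalSpace.isTopologicalBasis_of_isOpen_of_nhds ?_ ?_
      · rintro _ ⟨c, r, rfl⟩
        exact Metric.isOpen_ball
      · intro a u ha hu
        obtain ⟨r, hr, h⟩ := Metric.isOpen_iff.1 hu a ha
        exact ⟨_, ⟨a, r, rfl⟩, Metric.mem_ball_self hr, h⟩
    have hfin : IsFiniteMeasure ((Measure.map (fun w => w ^ 2) m).restrict (Metric.ball b ‖b‖)) := by
      refine ⟨?_⟩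
      rw [Measure.restrict_apply_univ, Measure.map_apply (by fun_prop) measurableSet_ball]
      refine (measure_mono (t := Metric.ball (0 : ℚ_[p]) (‖b‖ + 1)) fun w hw => ?_).trans_lt
        measure_ball_lt_top
      simp only [Metric.mem_ball, Set.mem_preimage, dist_eq_norm] at hw
      have := norm_eq_of_near _ _ hw
      rw [norm_pow] at this
      simp only [Metric.mem_ball, dist_zero_right]
      nlinarith [norm_nonneg w, norm_nonneg b]
    refine ext_of_generate_finite _ (BorelSpace.measurable_eq.trans hbas.borel_eq_generateFrom)
      ?_ ?_ ?_
    · rintro _ ⟨c, r, rfl⟩ _ ⟨d, r', rfl⟩ ⟨x, hx1, hx2⟩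
      refine ⟨x, min r r', ?_⟩
      rw [IsUltrametricDist.ball_eq_of_mem hx1, IsUltrametricDist.ball_eq_of_mem hx2]
      ext y
      simp
    · rintro _ ⟨c, r, rfl⟩
      rw [Measure.restrict_apply measurableSet_ball, Measure.restrict_apply measurableSet_ball]
      rcases Set.eq_empty_or_nonempty (Metric.ball c r ∩ Metric.ball b ‖b‖) with h | ⟨x, hx1, hx2⟩
      · simp [h]
      · have : Metric.ball c r ∩ Metric.ball b ‖b‖ = Metric.ball x (min r ‖b‖) := by
          rw [IsUltrametricDist.ball_eq_of_mem hx1, IsUltrametricDist.ball_eq_of_mem hx2]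
          ext y
          simp
        rw [this]
        rw [Metric.mem_ball, dist_eq_norm] at hx2
        have hxn := norm_eq_of_near _ _ hx2
        refine ball_eq hp m hm s hs_sq x ?_ _ ?_
        · rw [← norm_pos_iff, hxn]; exact norm_pos_iff.2 hq'
        · rw [hxn]; exact min_le_right _ _
    · rw [Measure.restrict_apply_univ, Measure.restrict_apply_univ]
      exact ball_eq hp m hm s hs_sq b hq' _ le_rfl

lemma mp_lin (hp : 2 < p) (m : Measure ℚ_[p]) [m.IsAddHaarMeasure]
    (hm : m {x : ℚ_[p] | ‖x‖ ≤ 1} = 1) :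
    Measure.map (fun z : ℚ_[p] × ℚ_[p] => (z.1 + z.2, z.1 - z.2)) (m.prod m) = m.prod m := by
  have h1 : MeasurePreserving (fun z : ℚ_[p] × ℚ_[p] => (z.1, z.1 + z.2)) (m.prod m) (m.prod m) :=
    measurePreserving_prod_add m m
  have h2 : MeasurePreserving Prod.swap (m.prod m) (m.prod m) := Measure.measurePreserving_swap
  have h3 : MeasurePreserving (Prod.map id (fun x : ℚ_[p] => 2 * x)) (m.prod m) (m.prod m) :=
    (MeasurePreserving.id m).prod ⟨by fun_prop, scale_unit m hm 2 (norm_two hp)⟩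
  have h4 : MeasurePreserving (fun z : ℚ_[p] × ℚ_[p] => (z.1, z.2 - z.1)) (m.prod m) (m.prod m) :=
    measurePreserving_prod_sub m m
  have h := (h4.comp (h3.comp (h2.comp h1))).map_eq
  convert h using 2
  ext z
  · simp
  · simp; ring

lemma map_Phi (hp : 2 < p) (m : Measure ℚ_[p]) [m.IsAddHaarMeasure]
    (hm : m {x : ℚ_[p] | ‖x‖ ≤ 1} = 1) (s : ℚ_[p] → ℚ_[p])
    (hs_sq : ∀ x : ℚ_[p], (∃ t : ℚ_[p], x = t ^ 2) → (s x) ^ 2 = x)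
    (hd : Measurable (dens p s)) :
    Measure.map (fun z : ℚ_[p] × ℚ_[p] => (z.1 + z.2, (z.1 - z.2) ^ 2)) (m.prod m) =
      (m.prod m).withDensity (fun z => dens p s z.2) := by
  have : (fun z : ℚ_[p] × ℚ_[p] => (z.1 + z.2, (z.1 - z.2) ^ 2)) =
    (Prod.map id (fun w : ℚ_[p] => w ^ 2)) ∘ (fun z => (z.1 + z.2, z.1 - z.2)) := rfl
  rw [this, ← Measure.map_map (by fun_prop) (by fun_prop), mp_lin hp m hm,
    ← Measure.map_prod_map _ _ (by fun_prop) (by fun_prop), map_sq hp m hm s hs_sq, Measure.map_id,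
    prod_withDensity_right hd]

lemma map_withDensity_comp {α β : Type*} [MeasurableSpace α] [MeasurableSpace β] (μ : Measure α)
    (F : α → β) (hF : Measurable F) (f : β → ENNReal) (hf : Measurable f) :
    Measure.map F (μ.withDensity (fun a => f (F a))) = (Measure.map F μ).withDensity f := by
  ext t ht
  rw [Measure.map_apply hF ht, withDensity_apply _ (hF ht), withDensity_apply _ ht,
    setLIntegral_map ht hf hF]

end SD

/-- Let `p > 2` be prime and `ξ, η` i.i.d. random variables with values in `ℚ_p` whose common
distribution has a continuous density `ρ` with respect to the Haar measure `m` on `ℚ_p`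
(normalized so that `m(ℤ_p) = 1`). Then (without assuming independence of `S` and `D`) the
distribution of `(S, D) = (ξ + η, (ξ - η)²)` is absolutely continuous with respect to the Haar
measure `m × m` on `ℚ_p²`, with density
`2·ρ((u + 𝔰(v))/2)·ρ((u - 𝔰(v))/2)·|𝔰(v)|_p⁻¹` at points `(u, v)` with
`v ∈ ℚ_p^{[2]} \ {0}` and density `0` elsewhere. -/
theorem density_of_sum_and_sq_diff (p : ℕ) [Fact p.Prime] (hp : 2 < p)
    [MeasurableSpace ℚ_[p]] [BorelSpace ℚ_[p]]
    (m : Measure ℚ_[p]) [m.IsAddHaarMeasure] (hm : m {x : ℚ_[p] | ‖x‖ ≤ 1} = 1)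
    (s : ℚ_[p] → ℚ_[p])
    (hs_cont : ContinuousOn s {x : ℚ_[p] | ∃ t : ℚ_[p], x = t ^ 2})
    (hs_sq : ∀ x : ℚ_[p], (∃ t : ℚ_[p], x = t ^ 2) → (s x) ^ 2 = x)
    {Ω : Type*} [MeasurableSpace Ω] (P : Measure Ω) [IsProbabilityMeasure P]
    (ξ η : Ω → ℚ_[p]) (hξ : Measurable ξ) (hη : Measurable η)
    (hindep : IndepFun ξ η P)
    (ρ : ℚ_[p] → ℝ) (hρc : Continuous ρ) (hρnn : ∀ x, 0 ≤ ρ x)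
    (hξd : Measure.map ξ P = m.withDensity fun x => ENNReal.ofReal (ρ x))
    (hηd : Measure.map η P = m.withDensity fun x => ENNReal.ofReal (ρ x)) :
    Measure.map (fun ω => (ξ ω + η ω, (ξ ω - η ω) ^ 2)) P =
      (m.prod m).withDensity
        (Set.indicator {q : ℚ_[p] × ℚ_[p] | (∃ t : ℚ_[p], q.2 = t ^ 2) ∧ q.2 ≠ 0}
          fun q => ENNReal.ofReal
            (2 * ρ ((q.1 + s q.2) / 2) * ρ ((q.1 - s q.2) / 2) * ‖s q.2‖⁻¹)) := by
  classical
  have hNS : MeasurableSet (SD.NS p) := (SD.NS_open hp).measurableSet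
  set s' : ℚ_[p] → ℚ_[p] := (SD.NS p).piecewise s (fun _ => 0) with hs'
  have hs'm : Measurable s' :=
    ContinuousOn.measurable_piecewise (hs_cont.mono fun x hx => hx.1) continuousOn_const hNS
  have hs'eq : ∀ v ∈ SD.NS p, s' v = s v := fun v hv => Set.piecewise_eq_of_mem _ _ _ hv
  have hs'sq : ∀ x : ℚ_[p], (∃ t : ℚ_[p], x = t ^ 2) → (s' x) ^ 2 = x := by
    intro x hx
    by_cases h0 : x = 0
    · rw [hs', Set.piecewise_eq_of_notMem _ _ _ (fun h => h.2 h0), h0]; simp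
    · rw [hs'eq x ⟨hx, h0⟩, hs_sq x hx]
  have hd : Measurable (SD.dens p s') := Measurable.indicator (by fun_prop) hNS
  let f : ℚ_[p] × ℚ_[p] → ENNReal := fun q =>
    ENNReal.ofReal (ρ ((q.1 + s' q.2) / 2)) * ENNReal.ofReal (ρ ((q.1 - s' q.2) / 2))
  have hρm : Measurable ρ := hρc.measurable
  have hf : Measurable f := by
    have h1 : Measurable fun q : ℚ_[p] × ℚ_[p] => (q.1 + s' q.2) / 2 := by fun_prop
    have h2 : Measurable fun q : ℚ_[p] × ℚ_[p] => (q.1 - s' q.2) / 2 := by fun_prop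
    exact (hρm.comp h1).ennreal_ofReal.mul (hρm.comp h2).ennreal_ofReal
  have hjoint := (indepFun_iff_map_prod_eq_prod_map_map hξ.aemeasurable hη.aemeasurable).1 hindep
  have hSF : SFinite m := inferInstance
  rw [hξd, hηd, prod_withDensity hρm.ennreal_ofReal hρm.ennreal_ofReal] at hjoint
  have hcomp : (fun ω => (ξ ω + η ω, (ξ ω - η ω) ^ 2)) =
      (fun z : ℚ_[p] × ℚ_[p] => (z.1 + z.2, (z.1 - z.2) ^ 2)) ∘ (fun ω => (ξ ω, η ω)) := rfl
  have h2 : (2 : ℚ_[p]) ≠ 0 := two_ne_zero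
  have hfe : (fun z : ℚ_[p] × ℚ_[p] => ENNReal.ofReal (ρ z.1) * ENNReal.ofReal (ρ z.2)) =
      fun z => f (z.1 + z.2, (z.1 - z.2) ^ 2) := by
    ext ⟨x, y⟩
    have h := hs'sq ((x - y) ^ 2) ⟨_, rfl⟩
    rcases sq_eq_sq_iff_eq_or_eq_neg.1 h with h | h
    · simp only [f, h]
      rw [show (x + y + (x - y)) / 2 = x by field_simp; ring,
        show (x + y - (x - y)) / 2 = y by field_simp; ring]
    · simp only [f, h]
      rw [show (x + y + -(x - y)) / 2 = y by field_simp; ring,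
        show (x + y - -(x - y)) / 2 = x by field_simp; ring, mul_comm]
  rw [hcomp, ← Measure.map_map (by fun_prop) (by fun_prop), hjoint, hfe,
    SD.map_withDensity_comp _ _ (by fun_prop) f hf, SD.map_Phi hp m hm s' hs'sq hd,
    ← withDensity_mul _ (by fun_prop) hf]
  congr 1
  ext q
  by_cases hq : q.2 ∈ SD.NS p
  · rw [Set.indicator_of_mem (by exact hq)]
    simp only [Pi.mul_apply, SD.dens, Set.indicator_of_mem hq, f, hs'eq _ hq]
    rw [← ENNReal.ofReal_mul (hρnn _), ← ENNReal.ofReal_mul (by positivity)]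
    congr 1
    ring
  · rw [Set.indicator_of_notMem (by exact hq)]
    simp [SD.dens, Set.indicator_of_notMem hq]
end

section
/- Let p > 2 be prime. Let ξ and η be independent identically distributed random variables with values in ℚ_p whose common distribution μ has a density ρ with respect to the Haar measure m on ℚ_p, where ρ is continuous and ρ(0) > 0. Then the random variables S = ξ + η and D = (ξ − η)² are independent if and only if ρ satisfies the functional equation ρ(u)²·ρ(v)·ρ(−v) = ρ(0)²·ρ(u+v)·ρ(u−v) for all u, v ∈ ℚ_p. -/
open MeasureTheory ProbabilityTheory

theorem image_sq_measurable (p : ℕ) [Fact p.Prime] 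
    [MeasurableSpace ℚ_[p]] [BorelSpace ℚ_[p]] {C : Set ℚ_[p]} (hC : IsClosed C) :
    MeasurableSet ((fun x => x ^ 2) '' C) := by
  have h1 : C = ⋃ n : ℕ, C ∩ Metric.closedBall 0 n := by
    rw [← Set.inter_iUnion, Metric.iUnion_closedBall_nat, Set.inter_univ]
  rw [h1, Set.image_iUnion]
  refine MeasurableSet.iUnion fun n => ?_
  exact (((isCompact_closedBall 0 (n:ℝ)).inter_left hC).image (continuous_pow 2)).measurableSet

theorem indep_of_sq (p : ℕ) [Fact p.Prime] 
    [MeasurableSpace ℚ_[p]] [BorelSpace ℚ_[p]] 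
    {Ω : Type*} [MeasurableSpace Ω] (P : Measure Ω) [IsProbabilityMeasure P]
    (S d : Ω → ℚ_[p]) (hS : Measurable S) (hd : Measurable d)
    (hsym : P.map (fun ω => (S ω, d ω)) = P.map (fun ω => (S ω, - d ω)))
    (h : IndepFun S (fun ω => d ω ^ 2) P) : IndepFun S d P := by
  have hsym' : ∀ A B : Set ℚ_[p], MeasurableSet A → MeasurableSet B →
      P (S ⁻¹' A ∩ d ⁻¹' B) = P (S ⁻¹' A ∩ d ⁻¹' (-B)) := by
    intro A B hA hB
    have := congrArg (fun μ => μ (A ×ˢ B)) hsym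
    rw [Measure.map_apply (by fun_prop) (hA.prod hB),
      Measure.map_apply (by fun_prop) (hA.prod hB)] at this
    exact this
  rw [indepFun_iff_measure_inter_preimage_eq_mul] at h ⊢
  have heven : ∀ A C : Set ℚ_[p], MeasurableSet A → IsClosed C → -C = C →
      P (S ⁻¹' A ∩ d ⁻¹' C) = P (S ⁻¹' A) * P (d ⁻¹' C) := by
    intro A C hA hC hCe
    have h2 := h A _ hA (image_sq_measurable p hC)
    have h3 : (fun ω => d ω ^ 2) ⁻¹' ((fun x => x ^ 2) '' C) = d ⁻¹' C := by
      ext ω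
      simp only [Set.mem_preimage, Set.mem_image]
      constructor
      · rintro ⟨x, hx, hxe⟩
        rcases sq_eq_sq_iff_eq_or_eq_neg.1 hxe with h | h
        · rwa [← h]
        · rw [← hCe, Set.mem_neg, ← h]; exact hx
      · intro hx
        exact ⟨_, hx, rfl⟩
    rwa [h3] at h2
  have hclosed : ∀ A B : Set ℚ_[p], MeasurableSet A → IsClosed B →
      P (S ⁻¹' A ∩ d ⁻¹' B) = P (S ⁻¹' A) * P (d ⁻¹' B) := by
    intro A B hA hB
    have key : ∀ A : Set ℚ_[p], MeasurableSet A → P (S ⁻¹' A ∩ d ⁻¹' (B ∪ -B)) + P (S ⁻¹' A ∩ d ⁻¹' (B ∩ -B))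
        = 2 * P (S ⁻¹' A ∩ d ⁻¹' B) := by
      intro A hA
      have := measure_union_add_inter (μ := P) (S ⁻¹' A ∩ d ⁻¹' B)
        (t := S ⁻¹' A ∩ d ⁻¹' (-B)) ((hS hA).inter (hd hB.neg.measurableSet))
      rw [← Set.inter_union_distrib_left, ← Set.inter_inter_distrib_left,
        ← hsym' A B hA hB.measurableSet, ← two_mul] at this
      exact this
    have k1 := key A hA
    have k2 := key Set.univ MeasurableSet.univ
    simp only [Set.preimage_univ, Set.univ_inter] at k2
    rw [heven A _ hA (hB.union hB.neg) (by rw [Set.union_neg, neg_neg, Set.union_comm]),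
      heven A _ hA (hB.inter hB.neg) (by rw [Set.inter_neg, neg_neg, Set.inter_comm]), ← mul_add, k2,
      mul_left_comm] at k1
    exact ((ENNReal.mul_right_inj two_ne_zero ENNReal.ofNat_ne_top).1 k1).symm
  intro A B hA hB
  have hm : (P.restrict (S ⁻¹' A)).map d = P (S ⁻¹' A) • P.map d := by
    refine ext_of_generate_finite _ (BorelSpace.measurable_eq.trans borel_eq_generateFrom_isClosed)
      isPiSystem_isClosed ?_ ?_
    · intro C hC
      have hC : IsClosed C := hC
      rw [Measure.map_apply hd hC.measurableSet, Measure.restrict_apply (hd hC.measurableSet),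
        Set.inter_comm, hclosed A C hA hC, Measure.smul_apply, Measure.map_apply hd hC.measurableSet,
        smul_eq_mul]
    · rw [Measure.map_apply hd .univ, Measure.smul_apply, Measure.map_apply hd .univ]
      simp
  have := congrArg (fun μ => μ B) hm
  simp only [Measure.smul_apply, smul_eq_mul] at this
  rwa [Measure.map_apply hd hB, Measure.map_apply hd hB, Measure.restrict_apply (hd hB), Set.inter_comm] at this

noncomputable def TT (p : ℕ) [Fact p.Prime] : (ℚ_[p] × ℚ_[p]) ≃+ (ℚ_[p] × ℚ_[p]) where
  toFun z := (z.1 + z.2, z.1 - z.2)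
  invFun z := ((z.1 + z.2) / 2, (z.1 - z.2) / 2)
  left_inv z := by ext <;> simp <;> ring
  right_inv z := by ext <;> simp <;> ring
  map_add' x y := by ext <;> simp <;> ring

theorem law_TT (p : ℕ) [Fact p.Prime] 
    [MeasurableSpace ℚ_[p]] [BorelSpace ℚ_[p]]
    (m : Measure ℚ_[p]) [m.IsAddHaarMeasure] (g : ℚ_[p] → ENNReal) (hg : Measurable g) 
    [SFinite (m.withDensity g)] : 
    ∃ c : ENNReal, c ≠ 0 ∧ c ≠ ⊤ ∧ 
     ((m.withDensity g).prod (m.withDensity g)).map (fun z => (z.1 + z.2, z.1 - z.2))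
      = (m.prod m).withDensity (fun z => c * (g ((z.1 + z.2) / 2) * g ((z.1 - z.2) / 2))) := by
  have hT : Continuous (TT p) := by
    change Continuous (fun z : ℚ_[p] × ℚ_[p] => (z.1 + z.2, z.1 - z.2)); fun_prop
  have hTs : Continuous (TT p).symm := by
    change Continuous (fun z : ℚ_[p] × ℚ_[p] => ((z.1 + z.2) / 2, (z.1 - z.2) / 2)); fun_prop
  have := (TT p).isAddHaarMeasure_map (m.prod m) hT hTs
  have hc := Measure.isAddLeftInvariant_eq_smul ((m.prod m).map (TT p)) (m.prod m)
  have hcp := Measure.addHaarScalarFactor_pos_of_isAddHaarMeasure ((m.prod m).map (TT p)) (m.prod m)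
  set c0 := Measure.addHaarScalarFactor ((m.prod m).map (TT p)) (m.prod m)
  obtain ⟨c, hcc⟩ : ∃ c : ENNReal, c = (c0 : ENNReal) := ⟨_, rfl⟩
  replace hc : (m.prod m).map (TT p) = c • m.prod m := by rw [hcc]; exact hc
  refine ⟨c, by rw [hcc]; exact_mod_cast hcp.ne', by rw [hcc]; exact ENNReal.coe_ne_top, ?_⟩
  change Measure.map (TT p) _ = _
  rw [prod_withDensity hg hg]
  have hGm : Measurable (fun z : ℚ_[p] × ℚ_[p] => g ((z.1 + z.2) / 2) * g ((z.1 - z.2) / 2)) := by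
    fun_prop
  have := withDensity_smul (μ := m.prod m) c hGm
  change _ = (m.prod m).withDensity (c • fun z : ℚ_[p] × ℚ_[p] => g ((z.1 + z.2) / 2) * g ((z.1 - z.2) / 2))
  rw [this, ← withDensity_smul_measure, ← hc]
  ext s hs
  rw [Measure.map_apply hT.measurable hs, withDensity_apply _ (hT.measurable hs), withDensity_apply _ hs,
    setLIntegral_map hs hGm hT.measurable]
  congr 1
  ext z
  have h1 := (TT p).left_inv z
  have e1 : ((TT p z).1 + (TT p z).2) / 2 = z.1 := congrArg Prod.fst h1
  have e2 : ((TT p z).1 - (TT p z).2) / 2 = z.2 := congrArg Prod.snd h1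
  rw [e1, e2]

theorem cont_factor (p : ℕ) [Fact p.Prime] 
    [MeasurableSpace ℚ_[p]] [BorelSpace ℚ_[p]]
    (m : Measure ℚ_[p]) [m.IsAddHaarMeasure] (F : ℚ_[p] → ℚ_[p] → ℝ)
    (hF : Continuous (fun z : ℚ_[p] × ℚ_[p] => F z.1 z.2)) (a b : ℚ_[p] → ℝ)
    (h : ∀ᵐ s ∂m, ∀ᵐ d ∂m, F s d = a s * b d) (s s' d d' : ℚ_[p]) :
    F s d * F s' d' = F s d' * F s' d := by
  have hF' : ∀ {X : Type} [TopologicalSpace X] (f g : X → ℚ_[p]), Continuous f → Continuous g →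
    Continuous (fun x => F (f x) (g x)) := fun f g hf hg => hF.comp (hf.prodMk hg)
  have ext1 : ∀ f g : ℚ_[p] → ℝ, Continuous f → Continuous g → (∀ᵐ x ∂m, f x = g x) → ∀ x, f x = g x := by
    intro f g hf hg h
    exact congrFun ((Continuous.ae_eq_iff_eq m hf hg).1 h)
  revert s
  refine ext1 _ _ ((hF' _ _ (by fun_prop) (by fun_prop)).mul (hF' _ _ (by fun_prop) (by fun_prop))) ((hF' _ _ (by fun_prop) (by fun_prop)).mul (hF' _ _ (by fun_prop) (by fun_prop))) ?_
  filter_upwards [h] with s hs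
  revert s'
  refine ext1 _ _ ((hF' _ _ (by fun_prop) (by fun_prop)).mul (hF' _ _ (by fun_prop) (by fun_prop))) ((hF' _ _ (by fun_prop) (by fun_prop)).mul (hF' _ _ (by fun_prop) (by fun_prop))) ?_
  filter_upwards [h] with s' hs'
  revert d
  refine ext1 _ _ ((hF' _ _ (by fun_prop) (by fun_prop)).mul (hF' _ _ (by fun_prop) (by fun_prop))) ((hF' _ _ (by fun_prop) (by fun_prop)).mul (hF' _ _ (by fun_prop) (by fun_prop))) ?_
  filter_upwards [hs, hs'] with d h1 h2
  revert d'
  refine ext1 _ _ ((hF' _ _ (by fun_prop) (by fun_prop)).mul (hF' _ _ (by fun_prop) (by fun_prop))) ((hF' _ _ (by fun_prop) (by fun_prop)).mul (hF' _ _ (by fun_prop) (by fun_prop))) ?_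
  filter_upwards [hs, hs'] with d' h3 h4
  rw [h1, h2, h3, h4]; ring

theorem indep_of_prod {α β : Type*} [MeasurableSpace α] [MeasurableSpace β]
    {Ω : Type*} [MeasurableSpace Ω] (P : Measure Ω) [IsProbabilityMeasure P]
    (S : Ω → α) (d : Ω → β) (hS : Measurable S) (hd : Measurable d)
    (μ : Measure α) (ν : Measure β) [SFinite μ] [SFinite ν]
    (h : P.map (fun ω => (S ω, d ω)) = μ.prod ν) : IndepFun S d P := by
  have key : ∀ A B, MeasurableSet A → MeasurableSet B → P (S ⁻¹' A ∩ d ⁻¹' B) = μ A * ν B := by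
    intro A B hA hB
    rw [← Measure.prod_prod, ← h, Measure.map_apply (by fun_prop) (hA.prod hB)]
    rfl
  rw [indepFun_iff_measure_inter_preimage_eq_mul]
  intro A B hA hB
  have h1 := key A _ hA .univ
  have h2 := key _ B .univ hB
  have h3 := key _ _ .univ .univ
  simp only [Set.preimage_univ, Set.univ_inter, Set.inter_univ, measure_univ] at h1 h2 h3
  rw [key A B hA hB, h1, h2]
  calc μ A * ν B = μ A * ν B * 1 := (mul_one _).symm
    _ = _ := by rw [h3]; ring

theorem indepFun_add_sq_sub_iff_density_funEq (p : ℕ) [Fact p.Prime] (hp : 2 < p)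
    [MeasurableSpace ℚ_[p]] [BorelSpace ℚ_[p]]
    (m : Measure ℚ_[p]) [m.IsAddHaarMeasure] (hm : m {x : ℚ_[p] | ‖x‖ ≤ 1} = 1)
    {Ω : Type*} [MeasurableSpace Ω] (P : Measure Ω) [IsProbabilityMeasure P]
    (ξ η : Ω → ℚ_[p]) (hξ : Measurable ξ) (hη : Measurable η)
    (hindep : IndepFun ξ η P)
    (ρ : ℚ_[p] → ℝ) (hρc : Continuous ρ) (hρnn : ∀ x, 0 ≤ ρ x) (hρ0 : 0 < ρ 0)
    (hξd : Measure.map ξ P = m.withDensity fun x => ENNReal.ofReal (ρ x))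
    (hηd : Measure.map η P = m.withDensity fun x => ENNReal.ofReal (ρ x)) :
    IndepFun (fun ω => ξ ω + η ω) (fun ω => (ξ ω - η ω) ^ 2) P ↔
      ∀ u v : ℚ_[p], (ρ u) ^ 2 * ρ v * ρ (-v) = (ρ 0) ^ 2 * ρ (u + v) * ρ (u - v) := by
  have hgm : Measurable (fun x => ENNReal.ofReal (ρ x)) := hρc.measurable.ennreal_ofReal
  have hjoint := (indepFun_iff_map_prod_eq_prod_map_map hξ.aemeasurable hη.aemeasurable).1 hindep
  have hjoint' := (indepFun_iff_map_prod_eq_prod_map_map hη.aemeasurable hξ.aemeasurable).1 hindep.symm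
  rw [hξd, hηd] at hjoint hjoint'
  have hSm : Measurable (fun ω => ξ ω + η ω) := hξ.add hη
  have hdm : Measurable (fun ω => ξ ω - η ω) := hξ.sub hη
  obtain ⟨c, hc0, hct, hlaw⟩ := law_TT p m _ hgm
  have hTm : Measurable (fun z : ℚ_[p] × ℚ_[p] => (z.1 + z.2, z.1 - z.2)) := by fun_prop
  have hsym : P.map (fun ω => (ξ ω + η ω, ξ ω - η ω)) = P.map (fun ω => (ξ ω + η ω, -(ξ ω - η ω))) := by
    have e1 := congrArg (Measure.map (fun z : ℚ_[p] × ℚ_[p] => (z.1 + z.2, z.1 - z.2)))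
      (hjoint.trans hjoint'.symm)
    rw [Measure.map_map hTm (by fun_prop), Measure.map_map hTm (by fun_prop)] at e1
    refine e1.trans (congrArg (fun f => Measure.map f P) ?_)
    funext ω
    simp [add_comm]
  have hlaw2 : P.map (fun ω => (ξ ω + η ω, ξ ω - η ω)) = (m.prod m).withDensity
      (fun z => c * (ENNReal.ofReal (ρ ((z.1 + z.2) / 2)) * ENNReal.ofReal (ρ ((z.1 - z.2) / 2)))) := by
    rw [← hlaw, ← hjoint, Measure.map_map hTm (by fun_prop)]
    rfl
  constructor
  · intro h
    have h2 := indep_of_sq p P _ _ hSm hdm hsym h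
    have h3 := (indepFun_iff_map_prod_eq_prod_map_map hSm.aemeasurable hdm.aemeasurable).1 h2
    have hnull : Measure.QuasiMeasurePreserving Prod.fst (m.prod m) m := Measure.quasiMeasurePreserving_fst
    have hac : P.map (fun ω => (ξ ω + η ω, ξ ω - η ω)) ≪ m.prod m := by
      rw [hlaw2]; exact withDensity_absolutelyContinuous _ _
    have hac1 : P.map (fun ω => ξ ω + η ω) ≪ m := by
      have := (hac.map (measurable_fst)).trans Measure.quasiMeasurePreserving_fst.absolutelyContinuous
      rwa [Measure.map_map measurable_fst (by fun_prop)] at this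
    have hac2 : P.map (fun ω => ξ ω - η ω) ≪ m := by
      have := (hac.map (measurable_snd)).trans Measure.quasiMeasurePreserving_snd.absolutelyContinuous
      rwa [Measure.map_map measurable_snd (by fun_prop)] at this
    have d1 := Measure.withDensity_rnDeriv_eq _ _ hac1
    have d2 := Measure.withDensity_rnDeriv_eq _ _ hac2
    set a := (P.map (fun ω => ξ ω + η ω)).rnDeriv m with ha
    set b := (P.map (fun ω => ξ ω - η ω)).rnDeriv m with hb
    have ham : Measurable a := Measure.measurable_rnDeriv _ _
    have hbm : Measurable b := Measure.measurable_rnDeriv _ _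
    rw [← d1, ← d2, prod_withDensity ham hbm, hlaw2, withDensity_eq_iff_of_sigmaFinite
      (by fun_prop) (by fun_prop)] at h3
    have h4 := Measure.ae_ae_of_ae_prod h3
    have h5 := cont_factor p m (fun s d => c.toReal * (ρ ((s + d) / 2) * ρ ((s - d) / 2)))
      (by fun_prop) (fun s => (a s).toReal) (fun d => (b d).toReal) (by
        filter_upwards [h4] with s hs
        filter_upwards [hs] with d hd
        have := congrArg ENNReal.toReal hd
        simpa [ENNReal.toReal_mul, ENNReal.toReal_ofReal, hρnn] using this)
    intro u v
    have h6 := h5 (2 * u) 0 (2 * v) 0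
    have h2ne : (2 : ℚ_[p]) ≠ 0 := two_ne_zero
    have e1 : (2 * u + 2 * v) / 2 = u + v := by field_simp
    have e2 : (2 * u - 2 * v) / 2 = u - v := by field_simp
    have e3 : (0 - 2 * v) / 2 = -v := by field_simp; ring
    have e4 : (2 * u) / 2 = u := by field_simp
    have e5 : (2 * v) / 2 = v := by field_simp
    simp only [e1, e2, e3, add_zero, sub_zero, zero_add, e4, e5, zero_div] at h6
    have hcp : c.toReal ^ 2 ≠ 0 := pow_ne_zero _ (ENNReal.toReal_ne_zero.2 ⟨hc0, hct⟩)
    apply mul_left_cancel₀ hcp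
    linear_combination -h6
  · intro h
    have hprod : P.map (fun ω => (ξ ω + η ω, ξ ω - η ω)) =
        (m.withDensity (fun s => c * ENNReal.ofReal (ρ (s / 2) ^ 2))).prod
        (m.withDensity (fun d => ENNReal.ofReal (ρ (d / 2) * ρ (-(d / 2)) / ρ 0 ^ 2))) := by
      rw [hlaw2, prod_withDensity (by fun_prop) (by fun_prop)]
      congr 1
      ext z
      rw [mul_assoc, ← ENNReal.ofReal_mul (hρnn _), ← ENNReal.ofReal_mul (by positivity)]
      congr 2
      have := h (z.1 / 2) (z.2 / 2)
      rw [← add_div, ← sub_div] at this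
      field_simp
      linear_combination -this
    have := indep_of_prod P _ _ hSm hdm _ _ hprod
    exact this.comp measurable_id (measurable_id.pow_const 2)
end
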